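/- arXiv:1104.1381 — 9 statements merged into one kernel-verified Lean document; each statement's English description precedes it below -/
import Mathlib

section
/- Let X be a complex Banach space and let {K_{s,t}}_{0 ≤ s ≤ t} be a family of linear contractions on X such that K_{s,t} ∘ K_{t,u} = K_{s,u} for all s ≤ t ≤ u, K_{s,s} = id, and for each f ∈ X and each s the map t ↦ K_{s,t} f is continuous. Let D ⊆ X be a linear subspace such that for every f ∈ D and every t ≥ 0 the limit A_t f := lim_{h → 0⁺} h⁻¹(K_{t,t+h} f − f) exists in X and t ↦ A_t f is continuous. Let B ⊆ X be a linear subspace with D ⊆ B, equipped with a norm ‖·‖_B such that ‖f‖ ≤ ‖f‖_B for f ∈ B, D is ‖·‖_B-dense in B, and ‖A_t f‖ ≤ ‖f‖_B for all f ∈ D and all t ≥ 0. Then for every g ∈ B and every t ≥ 0 the limit A_t g := lim_{h → 0⁺} h⁻¹(K_{t,t+h} g − g) exists in X, and for all 0 ≤ s ≤ t one has the integral identity K_{s,t} g = g + ∫_s^t K_{s,v}(A_v g) dv (a Bochner integral in X). -/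
open Filter Topology MeasureTheory

/-- A strongly continuous family of contractions on `[s, ∞)`, applied to a continuous curve,
gives a continuous curve. -/
theorem continuousOn_contraction_apply {X : Type*} [NormedAddCommGroup X] [NormedSpace ℂ X]
    {T : ℝ → X →L[ℂ] X} {s : ℝ} (hT : ∀ t, s ≤ t → ‖T t‖ ≤ 1)
    (hTc : ∀ f : X, ContinuousOn (fun t => T t f) (Set.Ici s))
    {F : ℝ → X} (hF : ContinuousOn F (Set.Ici s)) :
    ContinuousOn (fun t => T t (F t)) (Set.Ici s) := by
  intro v hv
  have h1 : Tendsto (fun w => T w (F w - F v)) (𝓝[Set.Ici s] v) (𝓝 0) := by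
    have h2 : Tendsto (fun w => ‖F w - F v‖) (𝓝[Set.Ici s] v) (𝓝 0) := by
      simpa using ((hF v hv).tendsto.sub_const (F v)).norm
    refine squeeze_zero_norm' ?_ h2
    filter_upwards [self_mem_nhdsWithin] with w hw
    simpa using (T w).le_of_opNorm_le (hT w hw) (F w - F v)
  simpa [ContinuousWithinAt] using h1.add (hTc (F v) v hv).tendsto

/-- If `t ↦ A t f` is the generator of an evolution family of contractions along `f`, and it is
continuous in `t`, then the evolution of `f` is the integral of its right derivative. -/
theorem evolution_apply_eq_add_integral {X : Type*} [NormedAddCommGroup X] [NormedSpace ℂ X]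
    [CompleteSpace X] {K : ℝ → ℝ → X →L[ℂ] X}
    (hcontr : ∀ s t : ℝ, 0 ≤ s → s ≤ t → ‖K s t‖ ≤ 1)
    (hcomp : ∀ s t u : ℝ, 0 ≤ s → s ≤ t → t ≤ u → (K s t).comp (K t u) = K s u)
    (hid : ∀ s : ℝ, 0 ≤ s → K s s = ContinuousLinearMap.id ℂ X)
    (hcont : ∀ (f : X) (s : ℝ), 0 ≤ s → ContinuousOn (fun t => K s t f) (Set.Ici s))
    {f : X} {a : ℝ → X}
    (hgen : ∀ t : ℝ, 0 ≤ t →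
      Tendsto (fun h : ℝ => h⁻¹ • (K t (t + h) f - f)) (𝓝[>] 0) (𝓝 (a t)))
    (ha : ContinuousOn a (Set.Ici 0)) {s t : ℝ} (hs : 0 ≤ s) (hst : s ≤ t) :
    K s t f = f + ∫ v in s..t, K s v (a v) := by
  have hc : ContinuousOn (fun v => K s v (a v)) (Set.Ici s) :=
    continuousOn_contraction_apply (fun v hv => hcontr s v hs hv) (fun x => hcont x s hs)
      (ha.mono (Set.Ici_subset_Ici.2 hs))
  have hderiv : ∀ v ∈ Set.Ioo s t,
      HasDerivWithinAt (fun v => K s v f) (K s v (a v)) (Set.Ioi v) v := by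
    intro v hv
    have hv0 : 0 ≤ v := hs.trans hv.1.le
    rw [hasDerivWithinAt_iff_tendsto_slope' (by simp)]
    have hshift : Tendsto (fun w : ℝ => w - v) (𝓝[>] v) (𝓝[>] 0) := by
      refine tendsto_nhdsWithin_iff.2 ⟨?_, ?_⟩
      · have : Tendsto (fun w : ℝ => w - v) (𝓝 v) (𝓝 (v - v)) :=
          (continuous_id.sub continuous_const).tendsto v
        rw [sub_self] at this
        exact this.mono_left nhdsWithin_le_nhds
      · filter_upwards [self_mem_nhdsWithin] with w hw
        exact sub_pos.2 (Set.mem_Ioi.1 hw)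
    refine (((K s v).continuous.tendsto _).comp ((hgen v hv0).comp hshift)).congr' ?_
    filter_upwards [self_mem_nhdsWithin] with w hw
    have hK : K s w f = K s v (K v w f) := by
      rw [← hcomp s v w hs hv.1.le (le_of_lt hw)]; rfl
    simp [slope_def_module, hK, (K s v).map_smul_of_tower]
  have key := intervalIntegral.integral_eq_sub_of_hasDeriv_right_of_le hst
    ((hcont f s hs).mono Set.Icc_subset_Ici_self) hderiv
    ((hc.mono Set.Icc_subset_Ici_self).intervalIntegrable_of_Icc hst)
  rw [key, hid s hs]
  simp

/-- A right difference quotient of a curve with continuous integrand converges to the value of the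
integrand at the base point. -/
theorem tendsto_inv_smul_integral {X : Type*} [NormedAddCommGroup X] [NormedSpace ℝ X]
    [CompleteSpace X] {F : ℝ → X} {t : ℝ} (hF : ContinuousOn F (Set.Ici t)) :
    Tendsto (fun h : ℝ => h⁻¹ • ∫ v in t..t + h, F v) (𝓝[>] 0) (𝓝 (F t)) := by
  have hm : StronglyMeasurableAtFilter F (𝓝[>] t) := by
    refine ⟨Set.Ioi t, self_mem_nhdsWithin, ?_⟩
    exact (hF.mono Set.Ioi_subset_Ici_self).aestronglyMeasurable measurableSet_Ioi
  have hd : HasDerivWithinAt (fun u => ∫ v in t..u, F v) (F t) (Set.Ici t) t :=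
    intervalIntegral.integral_hasDerivWithinAt_right (by simp) hm
      ((hF t Set.self_mem_Ici).mono Set.Ioi_subset_Ici_self)
  rw [← hasDerivWithinAt_Ioi_iff_Ici, hasDerivWithinAt_iff_tendsto_slope' (by simp)] at hd
  have hshift : Tendsto (fun h : ℝ => t + h) (𝓝[>] 0) (𝓝[>] t) := by
    refine tendsto_nhdsWithin_iff.2 ⟨?_, ?_⟩
    · have : Tendsto (fun h : ℝ => t + h) (𝓝 0) (𝓝 (t + 0)) :=
        (continuous_const.add continuous_id).tendsto 0
      rw [add_zero] at this
      exact this.mono_left nhdsWithin_le_nhds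
    · filter_upwards [self_mem_nhdsWithin] with h hh
      exact lt_add_of_pos_right t hh
  refine (hd.comp hshift).congr fun h => ?_
  simp [slope_def_module]

/-- Parts (b) and (c) of the paper's basic proposition: for a strongly continuous
two-parameter family of contractions `K s t` with generators `A t` defined on a dense
subspace `D` of `(B, ‖·‖_B)` satisfying `‖A_t f‖ ≤ ‖f‖_B`, the generator extends to all
of `B`, and the Riemann/Bochner integral identity
`K s t g = g + ∫_s^t K s v (A v g) dv` holds. -/
theorem stmt_1 {X : Type*} [NormedAddCommGroup X] [NormedSpace ℂ X] [CompleteSpace X]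
    (K : ℝ → ℝ → X →L[ℂ] X)
    (hcontr : ∀ s t : ℝ, 0 ≤ s → s ≤ t → ‖K s t‖ ≤ 1)
    (hcomp : ∀ s t u : ℝ, 0 ≤ s → s ≤ t → t ≤ u → (K s t).comp (K t u) = K s u)
    (hid : ∀ s : ℝ, 0 ≤ s → K s s = ContinuousLinearMap.id ℂ X)
    (hcont : ∀ (f : X) (s : ℝ), 0 ≤ s → ContinuousOn (fun t => K s t f) (Set.Ici s))
    (D B : Submodule ℂ X) (hDB : D ≤ B)
    (A : ℝ → X → X)
    (hgen : ∀ f ∈ D, ∀ t : ℝ, 0 ≤ t →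
      Tendsto (fun h : ℝ => h⁻¹ • (K t (t + h) f - f)) (𝓝[>] 0) (𝓝 (A t f)))
    (hAcont : ∀ f ∈ D, ContinuousOn (fun t => A t f) (Set.Ici 0))
    (nB : X → ℝ)
    (hnB_add : ∀ f ∈ B, ∀ g ∈ B, nB (f + g) ≤ nB f + nB g)
    (hnB_smul : ∀ (c : ℂ), ∀ f ∈ B, nB (c • f) = ‖c‖ * nB f)
    (hle : ∀ f ∈ B, ‖f‖ ≤ nB f)
    (hdense : ∀ g ∈ B, ∀ ε : ℝ, 0 < ε → ∃ f ∈ D, nB (g - f) < ε)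
    (hbound : ∀ f ∈ D, ∀ t : ℝ, 0 ≤ t → ‖A t f‖ ≤ nB f) :
    ∀ g ∈ B, ∃ Ag : ℝ → X,
      (∀ t : ℝ, 0 ≤ t →
        Tendsto (fun h : ℝ => h⁻¹ • (K t (t + h) g - g)) (𝓝[>] 0) (𝓝 (Ag t))) ∧
      (∀ s t : ℝ, 0 ≤ s → s ≤ t →
        K s t g = g + ∫ v in s..t, K s v (Ag v)) := by
  intro g hg
  have hAsub : ∀ f ∈ D, ∀ f' ∈ D, ∀ t : ℝ, 0 ≤ t → A t (f - f') = A t f - A t f' := by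
    intro f hf f' hf' t ht
    refine tendsto_nhds_unique (hgen _ (D.sub_mem hf hf') t ht)
      (((hgen f hf t ht).sub (hgen f' hf' t ht)).congr fun h => ?_)
    rw [← smul_sub, map_sub]
    congr 1
    abel
  have hdist : ∀ f ∈ D, ∀ f' ∈ D, ∀ t : ℝ, 0 ≤ t →
      ‖A t f - A t f'‖ ≤ nB (g - f) + nB (g - f') := by
    intro f hf f' hf' t ht
    have h1 := hnB_add _ (B.sub_mem hg (hDB hf')) _
      (B.smul_mem (-1) (B.sub_mem hg (hDB hf)))
    rw [hnB_smul _ _ (B.sub_mem hg (hDB hf))] at h1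
    have h2 : g - f' + (-1 : ℂ) • (g - f) = f - f' := by
      rw [neg_one_smul]; abel
    rw [h2, norm_neg, norm_one, one_mul, add_comm] at h1
    rw [← hAsub f hf f' hf' t ht]
    exact (hbound _ (D.sub_mem hf hf') t ht).trans h1
  choose f hfD hfg using fun n : ℕ => hdense g hg (1 / ((n : ℝ) + 1)) (by positivity)
  have hnn : ∀ n, 0 ≤ nB (g - f n) := fun n =>
    (norm_nonneg _).trans (hle _ (B.sub_mem hg (hDB (hfD n))))
  have hnB0 : Tendsto (fun n => nB (g - f n)) atTop (𝓝 0) :=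
    squeeze_zero hnn (fun n => (hfg n).le) tendsto_one_div_add_atTop_nhds_zero_nat
  have hlim : ∀ t : ℝ, ∃ x, 0 ≤ t → Tendsto (fun n => A t (f n)) atTop (𝓝 x) := by
    intro t
    by_cases ht : 0 ≤ t
    · have h0 : Tendsto (fun n : ℕ => 1 / ((n : ℝ) + 1)) atTop (𝓝 0) :=
        tendsto_one_div_add_atTop_nhds_zero_nat
      have hc : CauchySeq fun n => A t (f n) := by
        refine cauchySeq_of_le_tendsto_0 (fun n : ℕ => 1 / ((n : ℝ) + 1) + 1 / ((n : ℝ) + 1)) ?_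
          (by simpa only [add_zero] using h0.add h0)
        intro n m N hn hm
        rw [dist_eq_norm]
        refine (hdist _ (hfD n) _ (hfD m) t ht).trans (add_le_add ?_ ?_)
        · exact (hfg n).le.trans (Nat.one_div_le_one_div hn)
        · exact (hfg m).le.trans (Nat.one_div_le_one_div hm)
      obtain ⟨x, hx⟩ := cauchySeq_tendsto_of_complete hc
      exact ⟨x, fun _ => hx⟩
    · exact ⟨0, fun h => absurd h ht⟩
  choose Ag hAg using hlim
  have hAgd : ∀ n, ∀ t : ℝ, 0 ≤ t → ‖Ag t - A t (f n)‖ ≤ nB (g - f n) := by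
    intro n t ht
    refine le_of_tendsto_of_tendsto' ((hAg t ht).sub_const (A t (f n))).norm
      (by simpa using hnB0.add_const (nB (g - f n)))
      fun m => hdist _ (hfD m) _ (hfD n) t ht
  have hAgc : ContinuousOn Ag (Set.Ici 0) := by
    have hu : TendstoUniformlyOn (fun n t => A t (f n)) Ag atTop (Set.Ici 0) := by
      rw [Metric.tendstoUniformlyOn_iff]
      intro ε hε
      filter_upwards [hnB0.eventually_lt_const hε] with n hn t ht
      rw [dist_eq_norm]
      exact (hAgd n t ht).trans_lt hn
    exact hu.continuousOn (Frequently.of_forall fun n => hAcont _ (hfD n))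
  have hKc : ∀ a : ℝ → X, ContinuousOn a (Set.Ici 0) → ∀ s : ℝ, 0 ≤ s →
      ContinuousOn (fun v => K s v (a v)) (Set.Ici s) := fun a ha s hs =>
    continuousOn_contraction_apply (fun v hv => hcontr s v hs hv) (fun x => hcont x s hs)
      (ha.mono (Set.Ici_subset_Ici.2 hs))
  have hint : ∀ s t : ℝ, 0 ≤ s → s ≤ t → K s t g = g + ∫ v in s..t, K s v (Ag v) := by
    intro s t hs hst
    have hfn : Tendsto f atTop (𝓝 g) := by
      rw [tendsto_iff_norm_sub_tendsto_zero]
      refine squeeze_zero (fun n => norm_nonneg _) (fun n => ?_) hnB0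
      rw [norm_sub_rev]
      exact hle _ (B.sub_mem hg (hDB (hfD n)))
    have hI : Tendsto (fun n => ∫ v in s..t, K s v (A v (f n))) atTop
        (𝓝 (∫ v in s..t, K s v (Ag v))) := by
      rw [tendsto_iff_norm_sub_tendsto_zero]
      refine squeeze_zero (fun n => norm_nonneg _) (fun n => ?_)
        (by simpa using hnB0.mul_const |t - s|)
      rw [← intervalIntegral.integral_sub
        (((hKc _ (hAcont _ (hfD n)) s hs).mono Set.Icc_subset_Ici_self).intervalIntegrable_of_Icc
          hst)
        (((hKc _ hAgc s hs).mono Set.Icc_subset_Ici_self).intervalIntegrable_of_Icc hst)]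
      refine intervalIntegral.norm_integral_le_of_norm_le_const fun v hv => ?_
      rw [Set.uIoc_of_le hst] at hv
      rw [← map_sub]
      refine ((K s v).le_of_opNorm_le (hcontr s v hs hv.1.le) _).trans ?_
      rw [one_mul, norm_sub_rev]
      exact hAgd n v (hs.trans hv.1.le)
    refine tendsto_nhds_unique (((K s t).continuous.tendsto g).comp hfn)
      ((hfn.add hI).congr fun n => ?_)
    exact (evolution_apply_eq_add_integral hcontr hcomp hid hcont (hgen _ (hfD n))
      (hAcont _ (hfD n)) hs hst).symm
  refine ⟨Ag, fun t ht => ?_, hint⟩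
  have h := tendsto_inv_smul_integral (hKc Ag hAgc t ht)
  rw [hid t ht, ContinuousLinearMap.id_apply] at h
  refine h.congr' ?_
  filter_upwards [self_mem_nhdsWithin] with u hu
  rw [hint t (t + u) ht (le_add_of_nonneg_right (le_of_lt hu)), add_sub_cancel_left]
end

section
/- Let (μ_t)_{t ≥ 0} be a family of Borel probability measures on ℝ, each having finite moments of all orders, with μ_0 = δ_0 (the Dirac mass at 0). Suppose that for every polynomial f (with real coefficients) the map t ↦ ∫_ℝ f dμ_t has a (right) derivative at t = 0, and define the cumulant functional C[f] := (d/dt)|_{t=0} ∫_ℝ f dμ_t. Then there exist α ∈ ℝ and a finite positive Borel measure ρ on ℝ with all moments finite such that for every polynomial f, C[f] = α f'(0) + ∫_ℝ (f(y) − f(0) − y f'(0))/y² dρ(y) (the integrand, being a polynomial in y, is defined everywhere). -/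
open MeasureTheory
open Filter Topology Set
open scoped NNReal ENNReal

/-- Truncation of a real number to the interval `[-R, R]`. -/
noncomputable def clip (R x : ℝ) : ℝ := max (-R) (min R x)

lemma continuous_clip (R : ℝ) : Continuous (clip R) := by
  unfold clip; fun_prop

lemma abs_clip_le {R : ℝ} (hR : 0 ≤ R) (x : ℝ) : |clip R x| ≤ R := by
  unfold clip
  grind

lemma clip_of_abs_le {R x : ℝ} (hx : |x| ≤ R) : clip R x = x := by
  unfold clip
  grind

lemma abs_clip_le_abs {R : ℝ} (hR : 0 ≤ R) (x : ℝ) : |clip R x| ≤ |x| := by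
  unfold clip
  grind

lemma norm_clip_pow_le {R : ℝ} (hR : 0 ≤ R) (k : ℕ) (x : ℝ) : ‖clip R x ^ k‖ ≤ R ^ k := by
  rw [norm_pow, Real.norm_eq_abs]
  gcongr
  exact abs_clip_le hR x

lemma abs_pow_sub_clip_pow_le {R : ℝ} (hR : 1 ≤ R) (k : ℕ) (x : ℝ) :
    |x ^ k - clip R x ^ k| ≤ 2 * x ^ (2 * (k + 1)) / R := by
  have hR0 : 0 < R := by linarith
  rcases le_or_gt |x| R with hx | hx
  · rw [clip_of_abs_le hx, sub_self, abs_zero, mul_comm 2 (k + 1), pow_mul]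
    positivity
  · have h1 : |clip R x ^ k| ≤ |x| ^ k := by
      rw [abs_pow]
      exact pow_le_pow_left₀ (abs_nonneg _) (abs_clip_le_abs hR0.le x) k
    have h2 : |x ^ k - clip R x ^ k| ≤ 2 * |x| ^ k := by
      refine (abs_sub _ _).trans ?_
      rw [abs_pow]
      linarith
    have h3 : |x| ^ k * R ≤ x ^ (2 * (k + 1)) := by
      have : x ^ (2 * (k + 1)) = |x| ^ (2 * (k + 1)) := by
        rw [pow_mul, pow_mul, sq_abs]
      rw [this]
      calc |x| ^ k * R ≤ |x| ^ k * |x| := by gcongr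
        _ = |x| ^ (k + 1) := (pow_succ _ _).symm
        _ ≤ |x| ^ (2 * (k + 1)) := pow_le_pow_right₀ (by linarith) (by omega)
    rw [le_div_iff₀ hR0]
    nlinarith

lemma integrable_clip_pow (ρ : Measure ℝ) [IsFiniteMeasure ρ] {R : ℝ} (hR : 0 ≤ R) (k : ℕ) :
    Integrable (fun x => clip R x ^ k) ρ :=
  .of_bound ((continuous_clip R).pow k).aestronglyMeasurable (R ^ k)
    (ae_of_all _ (norm_clip_pow_le hR k))

/-- The truncated moments approximate the moments, with an error controlled by a higher moment. -/
lemma abs_integral_pow_sub_integral_clip_pow_le (ρ : Measure ℝ) [IsFiniteMeasure ρ]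
    (hρ : ∀ n : ℕ, Integrable (fun x => x ^ n) ρ) {R : ℝ} (hR : 1 ≤ R) (k : ℕ) :
    |∫ x, x ^ k ∂ρ - ∫ x, clip R x ^ k ∂ρ| ≤ 2 * (∫ x, x ^ (2 * (k + 1)) ∂ρ) / R := by
  have hc := integrable_clip_pow ρ (zero_le_one.trans hR) k
  rw [← integral_sub (hρ k) hc, ← integral_const_mul, ← integral_div]
  refine abs_integral_le_integral_abs.trans
    (integral_mono ((hρ k).sub hc).abs (((hρ _).const_mul 2).div_const R) fun x => ?_)
  exact abs_pow_sub_clip_pow_le hR k x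

lemma integrable_pow_of_integrable_even_pow (ρ : Measure ℝ) [IsFiniteMeasure ρ]
    (hρ : ∀ n : ℕ, Integrable (fun x => x ^ (2 * n)) ρ) (n : ℕ) :
    Integrable (fun x => x ^ n) ρ := by
  refine ((integrable_const (1 : ℝ)).add (hρ n)).mono' (by fun_prop) (ae_of_all _ fun x => ?_)
  simp only [norm_pow, Real.norm_eq_abs, Pi.add_apply]
  rw [mul_comm, pow_mul, ← sq_abs, abs_pow]
  nlinarith [sq_nonneg (|x| ^ n - 1)]

lemma measureReal_compl_closedBall_le (ρ : Measure ℝ) [IsFiniteMeasure ρ]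
    (hρ : Integrable (fun x => x ^ 2) ρ) {R : ℝ} (hR : 1 ≤ R) :
    ρ.real (Metric.closedBall 0 R)ᶜ ≤ (∫ x, x ^ 2 ∂ρ) / R := by
  have hR0 : 0 < R := by linarith
  rw [le_div_iff₀ hR0]
  have h := mul_meas_ge_le_integral_of_nonneg (μ := ρ) (ae_of_all _ fun x : ℝ => sq_nonneg x) hρ R
  refine le_trans ?_ h
  rw [mul_comm]
  refine mul_le_mul_of_nonneg_left (measureReal_mono fun x hx => ?_) hR0.le
  simp only [mem_compl_iff, Metric.mem_closedBall, dist_zero_right, Real.norm_eq_abs,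
    not_le] at hx
  rw [mem_ofPred_eq, ← sq_abs]
  nlinarith

/-- Along a filter, convergent moments of finite measures are the moments of a finite measure. -/
lemma exists_finiteMeasure_of_tendsto_moments {ι : Type*} (F : Filter ι) [F.NeBot]
    (ν : ι → FiniteMeasure ℝ) (hν : ∀ i, ∀ n : ℕ, Integrable (fun x => x ^ n) (ν i : Measure ℝ))
    (m : ℕ → ℝ)
    (hm : ∀ n : ℕ, Tendsto (fun i => ∫ x, x ^ n ∂(ν i : Measure ℝ)) F (𝓝 (m n))) :
    ∃ ρ : FiniteMeasure ℝ, ∀ n : ℕ, Integrable (fun x => x ^ n) (ρ : Measure ℝ) ∧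
      ∫ x, x ^ n ∂(ρ : Measure ℝ) = m n := by
  set G : Ultrafilter ι := Ultrafilter.of F
  have hG : (G : Filter ι) ≤ F := Ultrafilter.of_le F
  let C : ℝ≥0 := (m 0 + 1).toNNReal
  let D : ℝ≥0 := (m 2 + 1).toNNReal
  have hu : Tendsto (fun n : ℕ => D / ((n : ℝ≥0) + 1)) atTop (𝓝 0) := by
    rw [← NNReal.tendsto_coe]
    simpa [div_eq_mul_inv] using (tendsto_one_div_add_atTop_nhds_zero_nat (𝕜 := ℝ)).const_mul (D : ℝ)
  have hcomp := isCompact_setOfPred_finiteMeasure_mass_le_compl_isCompact_le (E := ℝ)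
    (K := fun n : ℕ => Metric.closedBall 0 ((n : ℝ) + 1)) C hu
    (fun n => isCompact_closedBall _ _) (Or.inl inferInstance)
  have hmem : ∀ᶠ i in F, ν i ∈ {μ : FiniteMeasure ℝ | μ.mass ≤ C ∧
      ∀ n : ℕ, μ (Metric.closedBall 0 ((n : ℝ) + 1))ᶜ ≤ D / ((n : ℝ≥0) + 1)} := by
    filter_upwards [(hm 0).eventually_le_const (lt_add_one _),
      (hm 2).eventually_le_const (lt_add_one _)] with i h0 h2
    refine ⟨?_, fun n => ?_⟩
    · rw [← NNReal.coe_le_coe]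
      refine le_trans (le_of_eq ?_) (h0.trans (Real.le_coe_toNNReal _))
      simp only [pow_zero, integral_const, smul_eq_mul, mul_one]
      rfl
    · rw [← NNReal.coe_le_coe]
      have h := measureReal_compl_closedBall_le (ν i : Measure ℝ) (hν i 2)
        (R := (n : ℝ) + 1) (by linarith [n.cast_nonneg (α := ℝ)])
      refine le_trans h ?_
      push_cast
      gcongr
      exact h2.trans (Real.le_coe_toNNReal _)
  obtain ⟨ρ, -, hρ⟩ := isCompact_iff_ultrafilter_le_nhds'.1 hcomp (G.map ν) (hG hmem)
  have hlim (k : ℕ) {R : ℝ} (hR : 0 ≤ R) :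
      Tendsto (fun i => ∫ x, clip R x ^ k ∂(ν i : Measure ℝ)) G
        (𝓝 (∫ x, clip R x ^ k ∂(ρ : Measure ℝ))) :=
    FiniteMeasure.tendsto_iff_forall_integral_tendsto.1 (show Tendsto ν G (𝓝 ρ) from hρ)
      (BoundedContinuousFunction.ofNormedAddCommGroup (fun x => clip R x ^ k)
        ((continuous_clip R).pow k) (R ^ k) (norm_clip_pow_le hR k))
  have heven (n : ℕ) : Integrable (fun x => x ^ (2 * n)) (ρ : Measure ℝ) := by
    have hcover : AECover (ρ : Measure ℝ) atTop fun N : ℕ => Icc (-(N : ℝ)) N :=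
      aecover_Icc (tendsto_neg_atTop_atBot.comp tendsto_natCast_atTop_atTop)
        tendsto_natCast_atTop_atTop
    refine hcover.integrable_of_integral_bounded_of_nonneg_ae (m (2 * n))
      (fun N => (continuous_pow _).continuousOn.integrableOn_compact isCompact_Icc)
      (ae_of_all _ fun x => by rw [pow_mul]; positivity) (.of_forall fun N => ?_)
    have hN : (0 : ℝ) ≤ N := N.cast_nonneg
    have h1 : ∫ x in Icc (-(N : ℝ)) N, x ^ (2 * n) ∂(ρ : Measure ℝ)
        ≤ ∫ x, clip N x ^ (2 * n) ∂(ρ : Measure ℝ) := by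
      rw [setIntegral_congr_fun (g := fun x => clip N x ^ (2 * n)) measurableSet_Icc
        fun x hx => by simp only [clip_of_abs_le (abs_le.2 hx)]]
      exact setIntegral_le_integral (integrable_clip_pow _ hN _)
        (ae_of_all _ fun x => by simp only [pow_mul, Pi.zero_apply]; positivity)
    refine h1.trans (le_of_tendsto_of_tendsto' (hlim _ hN) ((hm _).mono_left hG) fun i => ?_)
    refine integral_mono (integrable_clip_pow _ hN _) (hν i _) fun x => ?_
    simp only [pow_mul]
    exact pow_le_pow_left₀ (sq_nonneg _) (sq_le_sq.2 (abs_clip_le_abs hN x)) n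
  have hint := integrable_pow_of_integrable_even_pow (ρ : Measure ℝ) heven
  refine ⟨ρ, fun k => ⟨hint k, ?_⟩⟩
  have hbound {R : ℝ} (hR : 1 ≤ R) : |∫ x, x ^ k ∂(ρ : Measure ℝ) - m k| ≤
      (2 * (∫ x, x ^ (2 * (k + 1)) ∂(ρ : Measure ℝ)) + 2 * m (2 * (k + 1))) / R := by
    have h1 := abs_integral_pow_sub_integral_clip_pow_le (ρ : Measure ℝ) hint hR k
    have h2 : |m k - ∫ x, clip R x ^ k ∂(ρ : Measure ℝ)| ≤ 2 * m (2 * (k + 1)) / R :=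
      le_of_tendsto_of_tendsto'
        ((((hm k).mono_left hG).sub (hlim k (zero_le_one.trans hR))).abs)
        ((((hm (2 * (k + 1))).mono_left hG).const_mul 2).div_const R)
        fun i => abs_integral_pow_sub_integral_clip_pow_le (ν i : Measure ℝ) (hν i) hR k
    rw [add_div]
    rw [abs_sub_comm (m k)] at h2
    exact (abs_sub_le _ _ _).trans (add_le_add h1 h2)
  have hle := ge_of_tendsto (tendsto_const_nhds.div_atTop tendsto_id)
    ((eventually_ge_atTop (1 : ℝ)).mono fun R hR => hbound hR)
  exact sub_eq_zero.1 (abs_nonpos_iff.1 hle)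

lemma integrable_eval_of_integrable_pow (ρ : Measure ℝ)
    (hρ : ∀ n : ℕ, Integrable (fun x => x ^ n) ρ) (f : Polynomial ℝ) :
    Integrable (fun x => f.eval x) ρ := by
  simp only [Polynomial.eval_eq_sum_range]
  exact integrable_finsetSum _ fun n _ => (hρ n).const_mul _

/-- A linear functional on polynomials is determined by its moments. -/
lemma linearMap_eq_integral_eval (ρ : Measure ℝ)
    (hρ : ∀ n : ℕ, Integrable (fun x => x ^ n) ρ) (L : Polynomial ℝ →ₗ[ℝ] ℝ)
    (hL : ∀ n : ℕ, ∫ x, x ^ n ∂ρ = L (Polynomial.X ^ n)) (q : Polynomial ℝ) :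
    L q = ∫ x, q.eval x ∂ρ := by
  conv_lhs => rw [q.as_sum_range_C_mul_X_pow]
  simp only [Polynomial.eval_eq_sum_range]
  rw [integral_finsetSum _ fun n _ => (hρ n).const_mul _, map_sum]
  refine Finset.sum_congr rfl fun n _ => ?_
  rw [integral_const_mul, hL, ← Polynomial.smul_eq_C_mul, map_smul, smul_eq_mul]

/-- The measure `c x² dμ(x)`. -/
noncomputable def sqDensity (c : ℝ) (μ : Measure ℝ) : Measure ℝ :=
  μ.withDensity fun x => ENNReal.ofReal (c * x ^ 2)

lemma isFiniteMeasure_sqDensity (c : ℝ) {μ : Measure ℝ} (hμ : Integrable (fun x => x ^ 2) μ) :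
    IsFiniteMeasure (sqDensity c μ) :=
  isFiniteMeasure_withDensity_ofReal (hμ.const_mul c).hasFiniteIntegral

lemma integral_pow_sqDensity {c : ℝ} (hc : 0 ≤ c) (μ : Measure ℝ) (n : ℕ) :
    ∫ x, x ^ n ∂(sqDensity c μ) = c * ∫ x, x ^ (n + 2) ∂μ := by
  rw [sqDensity, integral_withDensity_eq_integral_toReal_smul (by fun_prop) (by simp),
    ← integral_const_mul]
  refine integral_congr_ae (ae_of_all _ fun x => ?_)
  simp only [smul_eq_mul]
  rw [ENNReal.toReal_ofReal (by positivity)]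
  ring

lemma integrable_pow_sqDensity {c : ℝ} (hc : 0 ≤ c) {μ : Measure ℝ}
    (hμ : ∀ n : ℕ, Integrable (fun x => x ^ n) μ) (n : ℕ) :
    Integrable (fun x => x ^ n) (sqDensity c μ) := by
  rw [sqDensity, integrable_withDensity_iff (by fun_prop) (by simp)]
  refine ((hμ (n + 2)).const_mul c).congr (ae_of_all _ fun x => ?_)
  simp only
  rw [ENNReal.toReal_ofReal (by positivity)]
  ring



/-- Canonical (Kolmogorov-type) representation of the cumulant functional: if `μ_t` are
probability measures with all moments finite, `μ_0 = δ_0`, and for each polynomial `f` the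
map `t ↦ ∫ f dμ_t` has right derivative `Cum f` at `t = 0`, then there are `α ∈ ℝ` and a
finite measure `ρ` with all moments finite such that
`Cum f = α f'(0) + ∫ (f(y) - f(0) - y f'(0)) / y² dρ(y)`,
the integrand being interpreted as the polynomial `q` with
`f = f(0) + f'(0)·X + X²·q`. -/
theorem stmt_2 (μ : ℝ → Measure ℝ)
    (hprob : ∀ t : ℝ, 0 ≤ t → IsProbabilityMeasure (μ t))
    (hmom : ∀ t : ℝ, 0 ≤ t → ∀ n : ℕ, Integrable (fun x => x ^ n) (μ t))
    (hzero : μ 0 = Measure.dirac 0)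
    (Cum : Polynomial ℝ → ℝ)
    (hCum : ∀ f : Polynomial ℝ,
      HasDerivWithinAt (fun t => ∫ x, f.eval x ∂(μ t)) (Cum f) (Set.Ici 0) 0) :
    ∃ (α : ℝ) (ρ : Measure ℝ), IsFiniteMeasure ρ ∧
      (∀ n : ℕ, Integrable (fun x => x ^ n) ρ) ∧
      ∀ f q : Polynomial ℝ,
        f = Polynomial.C (f.eval 0) + Polynomial.C (f.derivative.eval 0) * Polynomial.X
              + Polynomial.X ^ 2 * q →
        Cum f = α * f.derivative.eval 0 + ∫ y, q.eval y ∂ρ := by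
  have hint (t : ℝ) (ht : 0 ≤ t) (f : Polynomial ℝ) : Integrable (fun x => f.eval x) (μ t) :=
    integrable_eval_of_integrable_pow _ (hmom t ht) f
  have hunique {f : Polynomial ℝ} {c : ℝ}
      (h : HasDerivWithinAt (fun t => ∫ x, f.eval x ∂(μ t)) c (Ici 0) 0) : Cum f = c :=
    (uniqueDiffWithinAt_Ici 0).eq_deriv _ (hCum f) h
  let L : Polynomial ℝ →ₗ[ℝ] ℝ :=
    { toFun := Cum
      map_add' := fun f g => hunique <| ((hCum f).add (hCum g)).congr_of_mem (fun t ht => by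
        simp only [Polynomial.eval_add, Pi.add_apply]
        exact integral_add (hint t ht f) (hint t ht g)) self_mem_Ici
      map_smul' := fun c f => hunique <| by
        simpa only [Polynomial.eval_smul, smul_eq_mul, integral_const_mul, RingHom.id_apply]
          using (hCum f).const_mul c }
  have hC (a : ℝ) : Cum (Polynomial.C a) = 0 :=
    hunique <| (hasDerivWithinAt_const 0 (Ici 0) a).congr_of_mem (fun t ht => by
      have := hprob t ht
      simp) self_mem_Ici
  have hpos (n : ℕ) : (0 : ℝ) ≤ 1 / ((n : ℝ) + 1) := by positivity
  let ν (n : ℕ) : FiniteMeasure ℝ :=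
    ⟨sqDensity ((n : ℝ) + 1) (μ (1 / ((n : ℝ) + 1))),
      isFiniteMeasure_sqDensity _ (hmom _ (hpos n) 2)⟩
  have hseq : Tendsto (fun n : ℕ => 1 / ((n : ℝ) + 1)) atTop (𝓝[>] 0) :=
    tendsto_nhdsWithin_iff.2 ⟨tendsto_one_div_add_atTop_nhds_zero_nat,
      .of_forall fun n => by simp only [mem_Ioi]; positivity⟩
  have hlim (k : ℕ) : Tendsto (fun n => ∫ x, x ^ k ∂(ν n : Measure ℝ)) atTop
      (𝓝 (Cum (Polynomial.X ^ (k + 2)))) := by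
    have h := ((hasDerivWithinAt_iff_tendsto_slope' self_notMem_Ioi).1
      (hCum (Polynomial.X ^ (k + 2))).Ioi_of_Ici).comp hseq
    refine h.congr fun n => ?_
    simp only [Function.comp_apply, slope_def_field, hzero, integral_dirac, Polynomial.eval_pow,
      Polynomial.eval_X]
    rw [show (ν n : Measure ℝ) = sqDensity ((n : ℝ) + 1) (μ (1 / ((n : ℝ) + 1))) from rfl,
      integral_pow_sqDensity (by positivity)]
    simp [mul_comm]
  obtain ⟨ρ, hρ⟩ := exists_finiteMeasure_of_tendsto_moments atTop ν
    (fun n => integrable_pow_sqDensity (by positivity) (hmom _ (hpos n))) _ hlim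
  refine ⟨Cum Polynomial.X, ρ, inferInstance, fun n => (hρ n).1, fun f q hf => ?_⟩
  have hq := linearMap_eq_integral_eval (ρ : Measure ℝ) (fun n => (hρ n).1)
    (L ∘ₗ LinearMap.mulLeft ℝ (Polynomial.X ^ 2)) (fun n => by
      rw [(hρ n).2, LinearMap.comp_apply, LinearMap.mulLeft_apply, ← pow_add, add_comm 2 n]
      rfl) q
  rw [← hq]
  change L f = L Polynomial.X * _ + L (Polynomial.X ^ 2 * q)
  conv_lhs => rw [hf]
  rw [map_add, map_add, ← Polynomial.smul_eq_C_mul, map_smul, smul_eq_mul,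
    show L (Polynomial.C (f.eval 0)) = 0 from hC _]
  ring
end

section
/- Let ν be a Borel probability measure on ℝ with Cauchy transform G_ν(z) = ∫_ℝ 1/(z−x) dν(x), and set F_ν(z) = 1/G_ν(z) for z in the upper half-plane ℂ⁺. Let x ↦ κ_x be a Borel-measurable family of Borel probability measures on ℝ (a Markov kernel) such that for every x ∈ ℝ and every z ∈ ℂ⁺, ∫_ℝ 1/(z−y) dκ_x(y) = 1/(F_ν(z) − x). Then for every Borel measurable f : ℝ → [0, ∞) and every 1 ≤ p < ∞, ∫_ℝ (∫_ℝ f(y) dκ_x(y))^p dx ≤ ∫_ℝ f(x)^p dx, where dx denotes Lebesgue measure. In particular, the map f ↦ (x ↦ ∫ f dκ_x) is a contraction on L^p(ℝ, dx). -/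
open MeasureTheory ProbabilityTheory
open Filter Topology

/-- The Cauchy density is the Poisson kernel of the upper half-plane. -/
lemma cauchyPDFReal_eq_neg_im {z : ℂ} (hz : 0 < z.im) (y : ℝ) :
    cauchyPDFReal z.re z.im.toNNReal y = -Real.pi⁻¹ * ((z - (y : ℂ))⁻¹).im := by
  rw [cauchyPDFReal_def, Real.coe_toNNReal _ hz.le, Complex.inv_im, Complex.normSq_apply]
  simp only [Complex.sub_re, Complex.sub_im, Complex.ofReal_re, Complex.ofReal_im, sub_zero]
  rw [show (y - z.re) ^ 2 + z.im ^ 2 = (z.re - y) * (z.re - y) + z.im * z.im by ring]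
  ring

lemma cauchyPDFReal_comm (x y : ℝ) (γ : NNReal) :
    cauchyPDFReal x γ y = cauchyPDFReal y γ x := by
  simp only [cauchyPDFReal_def, ← neg_sub x y, neg_sq]

lemma integrable_inv_sub_ofReal (μ : Measure ℝ) [IsFiniteMeasure μ] {z : ℂ} (hz : 0 < z.im) :
    Integrable (fun u : ℝ ↦ (z - (u : ℂ))⁻¹) μ := by
  refine Integrable.of_bound (by fun_prop) (z.im)⁻¹ (ae_of_all _ fun u ↦ ?_)
  rw [norm_inv]
  refine inv_anti₀ hz ?_
  simpa [abs_of_pos hz] using Complex.abs_im_le_norm (z - (u : ℂ))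

lemma integrable_cauchyPDFReal_of_isFiniteMeasure (μ : Measure ℝ) [IsFiniteMeasure μ] {z : ℂ}
    (hz : 0 < z.im) : Integrable (cauchyPDFReal z.re z.im.toNNReal) μ := by
  rw [show cauchyPDFReal z.re z.im.toNNReal =
      fun y : ℝ ↦ -Real.pi⁻¹ * ((z - (y : ℂ))⁻¹).im from
    funext (cauchyPDFReal_eq_neg_im hz)]
  exact (integrable_inv_sub_ofReal μ hz).im.const_mul _

lemma integral_cauchyPDFReal_eq_neg_im (μ : Measure ℝ) [IsFiniteMeasure μ] {z : ℂ}
    (hz : 0 < z.im) :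
    ∫ y, cauchyPDFReal z.re z.im.toNNReal y ∂μ =
      -Real.pi⁻¹ * (∫ y, (z - (y : ℂ))⁻¹ ∂μ).im := by
  simp_rw [cauchyPDFReal_eq_neg_im hz, integral_const_mul]
  congr 1
  exact integral_im (𝕜 := ℂ) (integrable_inv_sub_ofReal μ hz)

/-- The reciprocal Cauchy transform of a probability measure preserves the upper half-plane. -/
lemma im_inv_integral_inv_sub_pos (ν : Measure ℝ) [IsProbabilityMeasure ν] {z : ℂ}
    (hz : 0 < z.im) : 0 < ((∫ u, (z - (u : ℂ))⁻¹ ∂ν)⁻¹).im := by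
  have hγ : z.im.toNNReal ≠ 0 := by simpa using hz
  have hpos : 0 < ∫ y, cauchyPDFReal z.re z.im.toNNReal y ∂ν := by
    rw [integral_pos_iff_support_of_nonneg (fun y ↦ (cauchyPDF_pos z.re hγ y).le)
      (integrable_cauchyPDFReal_of_isFiniteMeasure ν hz)]
    have : Function.support (cauchyPDFReal z.re z.im.toNNReal) = Set.univ :=
      Set.eq_univ_of_forall fun y ↦ (cauchyPDF_pos z.re hγ y).ne'
    simp [this]
  rw [integral_cauchyPDFReal_eq_neg_im ν hz] at hpos
  have him : (∫ u, (z - (u : ℂ))⁻¹ ∂ν).im < 0 := by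
    by_contra! h
    have := mul_nonneg (inv_nonneg.2 Real.pi_pos.le) h
    linarith
  rw [Complex.inv_im]
  refine div_pos (neg_pos.2 him) (Complex.normSq_pos.2 fun h ↦ ?_)
  simp [h] at him

lemma setLIntegral_cauchyPDF_eq {U : Set ℝ} (hU : MeasurableSet U) (y : ℝ) {γ : NNReal}
    (hγ : γ ≠ 0) :
    ∫⁻ t in U, cauchyPDF y γ t =
      ∫⁻ s, U.indicator (fun _ ↦ cauchyPDF 0 1 s) (y + γ * s) := by
  have hγ' : (γ : ℝ) ≠ 0 := by exact_mod_cast hγ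
  rw [← lintegral_indicator hU, ← lintegral_add_left_eq_self _ y]
  nth_rw 1 [← Real.smul_map_volume_mul_left hγ']
  rw [lintegral_smul_measure, lintegral_map (by fun_prop) (by fun_prop), smul_eq_mul,
    ← lintegral_const_mul _ (by fun_prop)]
  refine lintegral_congr fun s ↦ ?_
  by_cases h : y + γ * s ∈ U
  · simp only [Set.indicator_of_mem h, cauchyPDF_def]
    rw [← ENNReal.ofReal_mul (abs_nonneg _), abs_of_nonneg γ.coe_nonneg]
    congr 1
    simp only [cauchyPDFReal_def']
    simp
    field_simp
  · simp [h]

/-- Cauchy distributions concentrate at their location as the scale tends to `0`. -/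
lemma one_le_liminf_setLIntegral_cauchyPDF {U : Set ℝ} (hU : IsOpen U) {y : ℝ} (hy : y ∈ U)
    {γ : ℕ → NNReal} (hγ : ∀ n, γ n ≠ 0) (hγ0 : Tendsto γ atTop (𝓝 0)) :
    1 ≤ liminf (fun n ↦ ∫⁻ t in U, cauchyPDF y (γ n) t) atTop := by
  simp_rw [fun n ↦ setLIntegral_cauchyPDF_eq hU.measurableSet y (hγ n)]
  rw [← lintegral_cauchyPDF_eq_one 0 one_ne_zero]
  refine le_trans (lintegral_mono fun s ↦ ?_) (lintegral_liminf_le fun n ↦ ?_)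
  · have hlim : Tendsto (fun n ↦ y + γ n * s) atTop (𝓝 y) := by
      have := ((NNReal.tendsto_coe.2 hγ0).mul_const s).const_add y
      simpa using this
    refine le_liminf_of_le (by isBoundedDefault) ?_
    filter_upwards [hlim.eventually (hU.mem_nhds hy)] with n hn
    rw [Set.indicator_of_mem hn]
  · have : (fun s ↦ U.indicator (fun _ ↦ cauchyPDF 0 1 s) (y + γ n * s)) =
        ((fun s ↦ y + γ n * s) ⁻¹' U).indicator (cauchyPDF 0 1) := rfl
    rw [this]
    exact (measurable_cauchyPDF 0 1).indicator
      ((show Measurable fun s : ℝ ↦ y + γ n * s by fun_prop) hU.measurableSet)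

/-- A measure whose convolutions with all Cauchy densities are at most `1` is dominated by Lebesgue
measure. -/
lemma le_volume_of_lintegral_cauchyPDF_le_one (μ : Measure ℝ) [SFinite μ]
    (h : ∀ (t : ℝ) (γ : NNReal), γ ≠ 0 → ∫⁻ y, cauchyPDF t γ y ∂μ ≤ 1) : μ ≤ volume := by
  have hopen : ∀ U : Set ℝ, IsOpen U → μ U ≤ volume U := by
    intro U hU
    let γ : ℕ → NNReal := fun n ↦ 1 / ((n : NNReal) + 1)
    have hγ : ∀ n, γ n ≠ 0 := fun n ↦ by positivity
    have hγ0 : Tendsto γ atTop (𝓝 0) := tendsto_one_div_add_atTop_nhds_zero_nat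
    have hmeas : ∀ n, Measurable fun q : ℝ × ℝ ↦ cauchyPDF q.1 (γ n) q.2 := fun n ↦ by
      unfold cauchyPDF cauchyPDFReal
      fun_prop
    calc μ U = ∫⁻ _ in U, 1 ∂μ := by simp
      _ ≤ ∫⁻ y in U, liminf (fun n ↦ ∫⁻ t in U, cauchyPDF y (γ n) t) atTop ∂μ :=
        setLIntegral_mono' hU.measurableSet fun y hy ↦
          one_le_liminf_setLIntegral_cauchyPDF hU hy hγ hγ0
      _ ≤ liminf (fun n ↦ ∫⁻ y in U, (∫⁻ t in U, cauchyPDF y (γ n) t) ∂μ) atTop :=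
        lintegral_liminf_le fun n ↦ (hmeas n).lintegral_prod_right'
      _ ≤ liminf (fun _ : ℕ ↦ volume U) atTop := by
        refine liminf_le_liminf (Eventually.of_forall fun n ↦ ?_)
        rw [lintegral_lintegral_swap (hmeas n).aemeasurable]
        calc ∫⁻ t in U, ∫⁻ y in U, cauchyPDF y (γ n) t ∂μ ≤ ∫⁻ _ in U, 1 := by
              refine lintegral_mono fun t ↦ (setLIntegral_le_lintegral _ _).trans ?_
              simpa only [cauchyPDF_def, cauchyPDFReal_comm t] using h t (γ n) (hγ n)
          _ = volume U := by simp
      _ = volume U := by simp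
  refine Measure.le_iff'.2 fun s ↦ ?_
  rw [s.measure_eq_iInf_isOpen volume]
  exact le_iInf₂ fun U hsU ↦ le_iInf fun hU ↦ (measure_mono hsU).trans (hopen U hU)

/-- Spectral averaging: the average over Lebesgue measure of the kernel is dominated by Lebesgue
measure. -/
lemma volume_bind_le_volume (ν : Measure ℝ) [IsProbabilityMeasure ν]
    (κ : Kernel ℝ ℝ) [IsMarkovKernel κ]
    (hres : ∀ (x : ℝ) (z : ℂ), 0 < z.im →
      ∫ y, (z - (y : ℂ))⁻¹ ∂(κ x) = ((∫ u, (z - (u : ℂ))⁻¹ ∂ν)⁻¹ - (x : ℂ))⁻¹) :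
    (volume : Measure ℝ).bind κ ≤ volume := by
  refine le_volume_of_lintegral_cauchyPDF_le_one _ fun t γ hγ ↦ ?_
  rw [Measure.lintegral_bind κ.measurable.aemeasurable (by fun_prop)]
  set z : ℂ := ⟨t, γ⟩
  have hz : 0 < z.im := NNReal.coe_pos.2 (pos_iff_ne_zero.2 hγ)
  set F : ℂ := (∫ u, (z - (u : ℂ))⁻¹ ∂ν)⁻¹
  have hF : 0 < F.im := im_inv_integral_inv_sub_pos ν hz
  have key : ∀ x, ∫⁻ y, cauchyPDF t γ y ∂(κ x) = cauchyPDF F.re F.im.toNNReal x := by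
    intro x
    have hγz : γ = z.im.toNNReal := by simp [z]
    rw [show t = z.re from rfl, hγz]
    simp only [cauchyPDF_def]
    rw [← ofReal_integral_eq_lintegral_ofReal
      (integrable_cauchyPDFReal_of_isFiniteMeasure (κ x) hz)
      (ae_of_all _ fun y ↦ (cauchyPDF_pos z.re (hγz ▸ hγ) y).le),
      integral_cauchyPDFReal_eq_neg_im (κ x) hz, hres x z hz, cauchyPDFReal_eq_neg_im hF]
  simp_rw [key]
  rw [lintegral_cauchyPDF_eq_one _ (by simpa using hF)]

/-- Jensen's inequality for powers of lower Lebesgue integrals. -/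
lemma lintegral_rpow_le_lintegral_rpow {α : Type*} [MeasurableSpace α] (μ : Measure α)
    [IsProbabilityMeasure μ] {f : α → NNReal} (hf : Measurable f) {p : ℝ} (hp : 1 ≤ p) :
    (∫⁻ y, (f y : ENNReal) ∂μ) ^ p ≤ ∫⁻ y, (f y : ENNReal) ^ p ∂μ := by
  have h := eLpNorm'_le_eLpNorm'_of_exponent_le (f := fun y ↦ (f y : ℝ)) one_pos hp μ
    (by fun_prop)
  have hp0 : 0 < p := one_pos.trans_le hp
  simp only [eLpNorm', ENNReal.rpow_one, div_one, one_div] at h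
  rw [ENNReal.le_rpow_inv_iff hp0] at h
  simpa using h

/-- Transition operators of processes with freely independent increments are
`L^p`-contractions: if `κ` is a Markov kernel with
`∫ 1/(z - y) dκ_x(y) = 1/(F_ν(z) - x)` for all `x ∈ ℝ` and `z ∈ ℂ⁺`, where
`F_ν(z) = 1/G_ν(z)` is the reciprocal Cauchy transform of a probability measure `ν`,
then for every nonnegative Borel function `f` and every `1 ≤ p < ∞`,
`∫ (∫ f dκ_x)^p dx ≤ ∫ f^p dx` with respect to Lebesgue measure. -/
theorem stmt_3 (ν : Measure ℝ) [IsProbabilityMeasure ν]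
    (κ : Kernel ℝ ℝ) [IsMarkovKernel κ]
    (hres : ∀ (x : ℝ) (z : ℂ), 0 < z.im →
      ∫ y, (z - (y : ℂ))⁻¹ ∂(κ x) = ((∫ u, (z - (u : ℂ))⁻¹ ∂ν)⁻¹ - (x : ℂ))⁻¹)
    (f : ℝ → NNReal) (hf : Measurable f) (p : ℝ) (hp : 1 ≤ p) :
    ∫⁻ x, (∫⁻ y, (f y : ENNReal) ∂(κ x)) ^ p ≤ ∫⁻ x, (f x : ENNReal) ^ p := by
  calc ∫⁻ x, (∫⁻ y, (f y : ENNReal) ∂(κ x)) ^ p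
      ≤ ∫⁻ x, ∫⁻ y, (f y : ENNReal) ^ p ∂(κ x) :=
        lintegral_mono fun x ↦ lintegral_rpow_le_lintegral_rpow (κ x) hf hp
    _ = ∫⁻ y, (f y : ENNReal) ^ p ∂((volume : Measure ℝ).bind κ) :=
        (Measure.lintegral_bind κ.measurable.aemeasurable (by fun_prop)).symm
    _ ≤ ∫⁻ x, (f x : ENNReal) ^ p := lintegral_mono' (volume_bind_le_volume ν κ hres) le_rfl
end

section
/- Let D be the ℂ-linear span of the functions x ↦ 1/(z₁−x) − 1/(z₂−x) for z₁, z₂ ∈ ℂ∖ℝ. Then D is dense in the space W^∞ = {f : ℝ → ℂ : f is twice continuously differentiable, and both f and f'' vanish at infinity} with respect to the norm ‖f‖ = sup_x |f(x)| + sup_x |f''(x)|. That is, for every such f and every ε > 0 there exists g ∈ D with sup_x |f(x) − g(x)| + sup_x |f''(x) − g''(x)| < ε. -/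
open Filter Topology

open MeasureTheory BoundedContinuousFunction Complex

/-- The translate `x ↦ g (x - t)` of a bounded continuous function. -/
noncomputable def BoundedContinuousFunction.translate (g : ℝ →ᵇ ℂ) (t : ℝ) : ℝ →ᵇ ℂ :=
  g.compContinuous ⟨fun x => x - t, by fun_prop⟩

@[simp]
lemma BoundedContinuousFunction.translate_apply (g : ℝ →ᵇ ℂ) (t x : ℝ) :
    g.translate t x = g (x - t) := rfl

lemma BoundedContinuousFunction.continuous_translate {g : ℝ →ᵇ ℂ} (hg : UniformContinuous g) :
    Continuous g.translate := by
  rw [Metric.continuous_iff]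
  intro t ε hε
  obtain ⟨δ, hδ, h⟩ := Metric.uniformContinuous_iff.1 hg (ε / 2) (half_pos hε)
  refine ⟨δ, hδ, fun s hs => lt_of_le_of_lt ?_ (half_lt_self hε)⟩
  refine (BoundedContinuousFunction.dist_le (half_pos hε).le).2 fun x => (h ?_).le
  change dist (x - s) (x - t) < δ
  rwa [dist_sub_left]

/-- Continuous functions vanishing at infinity, as bounded continuous functions. -/
lemma exists_boundedContinuousFunction_of_tendsto_cocompact {f : ℝ → ℂ} (hf : Continuous f)
    (h0 : Tendsto f (cocompact ℝ) (𝓝 0)) :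
    ∃ g : ℝ →ᵇ ℂ, ⇑g = f ∧ UniformContinuous g :=
  ⟨(⟨⟨f, hf⟩, h0⟩ : ZeroAtInftyContinuousMap ℝ ℂ).toBCF, rfl,
    hf.uniformContinuous_of_tendsto_cocompact h0⟩

lemma continuous_cauchy_density : Continuous fun s : ℝ => Real.pi⁻¹ * (1 + s ^ 2)⁻¹ :=
  continuous_const.mul (Continuous.inv₀ (by fun_prop) fun s => by positivity)

/-- Averages of small translates against the standard Cauchy density converge uniformly. -/
lemma tendsto_integral_cauchy_smul_translate {g : ℝ →ᵇ ℂ} (hg : UniformContinuous g) :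
    Tendsto (fun y : ℝ => ∫ s : ℝ, (Real.pi⁻¹ * (1 + s ^ 2)⁻¹) • g.translate (y * s))
      (𝓝 0) (𝓝 g) := by
  have hc := continuous_translate hg
  have hlim : ∫ s : ℝ, (Real.pi⁻¹ * (1 + s ^ 2)⁻¹) • g.translate (0 * s) = g := by
    have h0 : g.translate 0 = g := by ext x; simp
    simp only [zero_mul, h0]
    rw [integral_smul_const, integral_const_mul, integral_univ_inv_one_add_sq,
      inv_mul_cancel₀ Real.pi_ne_zero, one_smul]
  nth_rw 2 [← hlim]
  refine tendsto_integral_filter_of_dominated_convergence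
    (fun s => Real.pi⁻¹ * (1 + s ^ 2)⁻¹ * ‖g‖) ?_ ?_ ?_ ?_
  · exact Eventually.of_forall fun y =>
      (continuous_cauchy_density.smul (hc.comp (continuous_const.mul continuous_id))).aestronglyMeasurable
  · refine Eventually.of_forall fun y => Eventually.of_forall fun s => ?_
    rw [norm_smul, Real.norm_of_nonneg (by positivity)]
    exact mul_le_mul_of_nonneg_left (norm_compContinuous_le _ _) (by positivity)
  · exact (integrable_inv_one_add_sq.const_mul _).mul_const _
  · refine Eventually.of_forall fun s => Tendsto.const_smul ?_ _
    exact (hc.comp (continuous_id.mul continuous_const)).tendsto 0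

/-- The `n`-th derivative of the Poisson kernel `x ↦ y / (π (x² + y²))`. -/
noncomputable def poissonDeriv (n : ℕ) (y x : ℝ) : ℂ :=
  (2 * Real.pi * I)⁻¹ * n.factorial *
    (((-(y * I) - x) ^ (n + 1))⁻¹ - ((y * I - x) ^ (n + 1))⁻¹)

lemma Complex.sub_ofReal_ne_zero {z : ℂ} (hz : z.im ≠ 0) (x : ℝ) : z - x ≠ 0 := fun h =>
  hz (by simpa using congrArg Complex.im h)

lemma hasDerivAt_inv_sub_ofReal_pow {z : ℂ} (hz : z.im ≠ 0) (n : ℕ) (x : ℝ) :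
    HasDerivAt (fun x : ℝ => ((z - x) ^ (n + 1))⁻¹) ((n + 1) * ((z - x) ^ (n + 2))⁻¹) x := by
  have h0 := sub_ofReal_ne_zero hz x
  have h := (((hasDerivAt_id (x : ℂ)).const_sub z).pow (n + 1)).inv (pow_ne_zero _ h0)
  have h' := h.comp_ofReal
  convert! h' using 1
  simp only [id]
  field_simp
  push_cast
  simp only [Pi.pow_apply]
  ring

lemma hasDerivAt_poissonDeriv {y : ℝ} (hy : 0 < y) (n : ℕ) (x : ℝ) :
    HasDerivAt (poissonDeriv n y) (poissonDeriv (n + 1) y x) x := by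
  have h := ((hasDerivAt_inv_sub_ofReal_pow (z := -(y * I)) (by simpa using hy.ne') n x).sub
    (hasDerivAt_inv_sub_ofReal_pow (z := y * I) (by simpa using hy.ne') n x)).const_mul
    ((2 * Real.pi * I)⁻¹ * n.factorial)
  convert! h using 1
  simp only [poissonDeriv, Nat.factorial_succ]
  push_cast
  ring

lemma continuous_poissonDeriv {y : ℝ} (hy : 0 < y) (n : ℕ) : Continuous (poissonDeriv n y) :=
  continuous_iff_continuousAt.2 fun x => (hasDerivAt_poissonDeriv hy n x).continuousAt

lemma deriv_poissonDeriv_comp_sub {y : ℝ} (hy : 0 < y) (n : ℕ) (t : ℝ) :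
    deriv (fun x => poissonDeriv n y (x - t)) = fun x => poissonDeriv (n + 1) y (x - t) :=
  funext fun x => ((hasDerivAt_poissonDeriv hy n (x - t)).comp_sub_const x t).deriv

lemma contDiff_two_poissonDeriv_comp_sub {y : ℝ} (hy : 0 < y) (n : ℕ) (t : ℝ) :
    ContDiff ℝ 2 fun x => poissonDeriv n y (x - t) := by
  have hd (n : ℕ) : Differentiable ℝ fun x => poissonDeriv n y (x - t) := fun x =>
    ((hasDerivAt_poissonDeriv hy n (x - t)).comp_sub_const x t).differentiableAt
  have hc : Continuous fun x => poissonDeriv (n + 1 + 1) y (x - t) :=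
    (continuous_poissonDeriv hy _).comp (continuous_id.sub continuous_const)
  have h1 : ContDiff ℝ 1 fun x => poissonDeriv (n + 1) y (x - t) :=
    contDiff_one_iff_deriv.2 ⟨hd _, by rwa [deriv_poissonDeriv_comp_sub hy]⟩
  exact (contDiff_succ_iff_deriv (n := 1)).2
    ⟨hd _, by simp, by rwa [deriv_poissonDeriv_comp_sub hy]⟩

lemma iteratedDeriv_two_poissonDeriv_comp_sub {y : ℝ} (hy : 0 < y) (t : ℝ) :
    iteratedDeriv 2 (fun x => poissonDeriv 0 y (x - t)) = fun x => poissonDeriv 2 y (x - t) := by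
  rw [iteratedDeriv_succ, iteratedDeriv_one, deriv_poissonDeriv_comp_sub hy,
    deriv_poissonDeriv_comp_sub hy]

lemma tendsto_poissonDeriv_cocompact (n : ℕ) (y : ℝ) :
    Tendsto (poissonDeriv n y) (cocompact ℝ) (𝓝 0) := by
  have h (z : ℂ) : Tendsto (fun x : ℝ => ((z - x) ^ (n + 1))⁻¹) (cocompact ℝ) (𝓝 0) := by
    have h1 : Tendsto (fun x : ℝ => z - x) (cocompact ℝ) (cocompact ℂ) :=
      ((Homeomorph.subLeft z).isClosedEmbedding.comp
        isometry_ofReal.isClosedEmbedding).tendsto_cocompact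
    rw [← Metric.cobounded_eq_cocompact (α := ℂ)] at h1
    have h2 := (tendsto_inv₀_cobounded.comp h1).pow (n + 1)
    simpa [Function.comp_def] using h2
  have h0 := ((h (-(y * I))).sub (h (y * I))).const_mul ((2 * Real.pi * I)⁻¹ * n.factorial)
  rwa [sub_zero, mul_zero] at h0

lemma poissonDeriv_zero_mul {y : ℝ} (hy : 0 < y) (s : ℝ) :
    poissonDeriv 0 y (y * s) = ((y⁻¹ * (Real.pi⁻¹ * (1 + s ^ 2)⁻¹) : ℝ) : ℂ) := by
  have h1 : (-(y * I) - ((y * s : ℝ) : ℂ)) ≠ 0 :=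
    sub_ofReal_ne_zero (by simpa using hy.ne') _
  have h2 : ((y * I) - ((y * s : ℝ) : ℂ)) ≠ 0 :=
    sub_ofReal_ne_zero (by simpa using hy.ne') _
  have h3 : ((1 + s ^ 2 : ℝ) : ℂ) ≠ 0 := by
    exact_mod_cast (by positivity : (1 + s ^ 2 : ℝ) ≠ 0)
  have hyc : (y : ℂ) ≠ 0 := by exact_mod_cast hy.ne'
  have hpi : (Real.pi : ℂ) ≠ 0 := by exact_mod_cast Real.pi_ne_zero
  push_cast at h1 h2 h3 ⊢
  simp only [poissonDeriv, zero_add, pow_one, Nat.factorial_zero, Nat.cast_one, mul_one]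
  push_cast
  have h4 : (-(y * I) - (y * s : ℂ)) * (y * I - y * s) = y ^ 2 * (1 + s ^ 2) := by
    linear_combination (-(y : ℂ) ^ 2) * I_sq
  rw [inv_sub_inv h1 h2, h4]
  field_simp
  ring

lemma integrable_poissonDeriv {y : ℝ} (hy : 0 < y) (n : ℕ) : Integrable (poissonDeriv n y) := by
  rcases n with _ | n
  · have h : Integrable fun s : ℝ => ((y⁻¹ * (Real.pi⁻¹ * (1 + s ^ 2)⁻¹) : ℝ) : ℂ) :=
      ((integrable_inv_one_add_sq.const_mul _).const_mul _).ofReal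
    simp_rw [← poissonDeriv_zero_mul hy] at h
    exact (integrable_comp_mul_left_iff (poissonDeriv 0 y) hy.ne').1 h
  · have key (z : ℂ) (hre : z.re = 0) (him : |z.im| = y) :
        Integrable fun x : ℝ => ((z - x) ^ (n + 2))⁻¹ := by
      have hz : z.im ≠ 0 := fun h => hy.ne' (by simpa [h] using him.symm)
      have hbase : Integrable fun x : ℝ => (y⁻¹) ^ n * ((y ^ 2)⁻¹ * (1 + (x / y) ^ 2)⁻¹) :=
        ((integrable_inv_one_add_sq.comp_div hy.ne').const_mul _).const_mul _
      refine hbase.mono' (Continuous.aestronglyMeasurable ?_) (Eventually.of_forall fun x => ?_)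
      · exact Continuous.inv₀ (by fun_prop) fun x => pow_ne_zero _ (sub_ofReal_ne_zero hz x)
      · have h1 : y ≤ ‖z - x‖ := by
          simpa [him] using Complex.abs_im_le_norm (z - x)
        have h2 : ‖z - x‖ ^ 2 = y ^ 2 * (1 + (x / y) ^ 2) := by
          rw [← Complex.normSq_eq_norm_sq, Complex.normSq_apply]
          simp only [sub_re, sub_im, ofReal_re, ofReal_im, hre, ← him]
          field_simp
          rw [sq_abs]
          ring
        rw [norm_inv, norm_pow, pow_add, mul_inv, h2, mul_inv, ← inv_pow]
        gcongr
    exact ((key _ (by simp) (by simp [hy.le])).sub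
      (key _ (by simp) (by simp [hy.le]))).const_mul _

/-- The average of translates against a Cauchy density is a Poisson integral. -/
lemma integral_cauchy_smul_translate_apply {g : ℝ →ᵇ ℂ} (hg : UniformContinuous g) {y : ℝ}
    (hy : 0 < y) (x : ℝ) :
    (∫ s : ℝ, (Real.pi⁻¹ * (1 + s ^ 2)⁻¹) • g.translate (y * s)) x =
      ∫ t : ℝ, g t * poissonDeriv 0 y (x - t) := by
  have hint : Integrable fun s : ℝ => (Real.pi⁻¹ * (1 + s ^ 2)⁻¹) • g.translate (y * s) := by
    refine ((integrable_inv_one_add_sq.const_mul Real.pi⁻¹).mul_const ‖g‖).mono'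
      (Continuous.aestronglyMeasurable ?_) (Eventually.of_forall fun s => ?_)
    · exact continuous_cauchy_density.smul
        ((continuous_translate hg).comp (continuous_const.mul continuous_id))
    · rw [norm_smul, Real.norm_of_nonneg (by positivity)]
      exact mul_le_mul_of_nonneg_left (norm_compContinuous_le _ _) (by positivity)
  have hyc : (y : ℂ) ≠ 0 := by exact_mod_cast hy.ne'
  calc (∫ s : ℝ, (Real.pi⁻¹ * (1 + s ^ 2)⁻¹) • g.translate (y * s)) x
      = ∫ s : ℝ, (Real.pi⁻¹ * (1 + s ^ 2)⁻¹) • g (x - y * s) :=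
        ((evalCLM ℝ x : (ℝ →ᵇ ℂ) →L[ℝ] ℂ).integral_comp_comm hint).symm
    _ = ∫ s : ℝ, y • (g (x - y * s) * poissonDeriv 0 y (y * s)) := by
        refine integral_congr_ae (Eventually.of_forall fun s => ?_)
        simp only [poissonDeriv_zero_mul hy, real_smul]
        push_cast
        field_simp
    _ = ∫ u : ℝ, g (x - u) * poissonDeriv 0 y u := by
        rw [integral_smul, Measure.integral_comp_mul_left
          (fun u => g (x - u) * poissonDeriv 0 y u) y, abs_of_pos (inv_pos.2 hy),
          smul_inv_smul₀ hy.ne']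
    _ = ∫ t : ℝ, g t * poissonDeriv 0 y (x - t) := by
        rw [← integral_sub_left_eq_self _ volume x]
        simp

/-- Poisson integrals of a uniformly continuous bounded function converge to it uniformly. -/
lemma eventually_norm_integral_poisson_sub_le {g : ℝ →ᵇ ℂ} (hg : UniformContinuous g) {ε : ℝ}
    (hε : 0 < ε) :
    ∀ᶠ y in 𝓝[>] (0 : ℝ), ∀ x, ‖g x - ∫ t : ℝ, g t * poissonDeriv 0 y (x - t)‖ ≤ ε := by
  have h := ((tendsto_integral_cauchy_smul_translate hg).mono_left
    (nhdsWithin_le_nhds (s := Set.Ioi 0))).eventually (Metric.ball_mem_nhds g hε)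
  filter_upwards [h, self_mem_nhdsWithin] with y hy hy0 x
  rw [← integral_cauchy_smul_translate_apply hg hy0, ← dist_eq_norm, dist_comm]
  exact (dist_coe_le_dist x).trans (le_of_lt hy)

/-- Convolutions of a function vanishing at infinity with an integrable kernel can be truncated
uniformly. -/
lemma eventually_norm_intervalIntegral_sub_integral_le {f k : ℝ → ℂ} (hf : Continuous f)
    (h0 : Tendsto f (cocompact ℝ) (𝓝 0)) (hk : Integrable k) {ε : ℝ} (hε : 0 < ε) :
    ∀ᶠ R in atTop, ∀ x, ‖(∫ t : ℝ, f t * k (x - t)) - ∫ t in (-R)..R, f t * k (x - t)‖ ≤ ε := by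
  obtain ⟨g, hg, -⟩ := exists_boundedContinuousFunction_of_tendsto_cocompact hf h0
  have hN : 0 ≤ ∫ t, ‖k t‖ := integral_nonneg fun t => norm_nonneg _
  set δ := ε / ((∫ t, ‖k t‖) + 1) with hδ
  have hδ0 : 0 < δ := by positivity
  have hev := h0.eventually (Metric.ball_mem_nhds (0 : ℂ) hδ0)
  rw [← Metric.cobounded_eq_cocompact, ← comap_norm_atTop, eventually_comap] at hev
  obtain ⟨R₀, hR₀⟩ := eventually_atTop.1 hev
  filter_upwards [eventually_ge_atTop R₀, eventually_ge_atTop 0] with R hR hR0 x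
  have hkx : Integrable fun t => k (x - t) := hk.comp_sub_left x
  have hint : Integrable fun t => f t * k (x - t) :=
    hkx.bdd_mul hf.aestronglyMeasurable (c := ‖g‖)
      (Eventually.of_forall fun t => hg ▸ g.norm_coe_le_norm t)
  rw [intervalIntegral.integral_of_le (by linarith),
    ← integral_add_compl (measurableSet_Ioc (a := -R) (b := R)) hint, add_sub_cancel_left]
  calc ‖∫ t in (Set.Ioc (-R) R)ᶜ, f t * k (x - t)‖
      ≤ ∫ t in (Set.Ioc (-R) R)ᶜ, δ * ‖k (x - t)‖ := by
        refine norm_integral_le_of_norm_le (hkx.norm.const_mul δ).integrableOn ?_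
        refine (ae_restrict_iff' measurableSet_Ioc.compl).2 (Eventually.of_forall fun t ht => ?_)
        rw [norm_mul]
        refine mul_le_mul_of_nonneg_right ?_ (norm_nonneg _)
        have hRt : R ≤ ‖t‖ := by
          by_contra! hlt
          rw [Real.norm_eq_abs, abs_lt] at hlt
          exact ht ⟨hlt.1, hlt.2.le⟩
        simpa using (hR₀ ‖t‖ (hR.trans hRt) t rfl).le
    _ ≤ ∫ t, δ * ‖k (x - t)‖ :=
        setIntegral_le_integral (hkx.norm.const_mul δ)
          (Eventually.of_forall fun t => by positivity)
    _ = δ * ∫ t, ‖k t‖ := by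
        rw [integral_const_mul, integral_sub_left_eq_self (fun t => ‖k t‖) volume x]
    _ ≤ ε := by
        rw [hδ, div_mul_eq_mul_div, div_le_iff₀ (by positivity)]
        nlinarith

/-- A Landau-type inequality: a function with bounded second derivative which is itself bounded
has bounded derivative. -/
lemma norm_deriv_le_of_norm_le_of_norm_deriv_two_le {f f' f'' : ℝ → ℂ} {A B : ℝ}
    (hf : ∀ x, HasDerivAt f (f' x) x) (hf' : ∀ x, HasDerivAt f' (f'' x) x)
    (hA : ∀ x, ‖f x‖ ≤ A) (hB : ∀ x, ‖f'' x‖ ≤ B) (x : ℝ) : ‖f' x‖ ≤ 2 * A + B := by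
  have hB0 : 0 ≤ B := (norm_nonneg _).trans (hB 0)
  have h1 : ∀ t ∈ Set.Icc x (x + 1), ‖f' t - f' x‖ ≤ B := fun t ht => by
    have := convex_univ.norm_image_sub_le_of_norm_hasDerivWithin_le
      (fun s _ => (hf' s).hasDerivWithinAt) (fun s _ => hB s) (Set.mem_univ x) (Set.mem_univ t)
    refine this.trans (mul_le_of_le_one_right hB0 ?_)
    rw [Real.norm_eq_abs, abs_le]
    constructor <;> linarith [ht.1, ht.2]
  have h2 := (convex_Icc x (x + 1)).norm_image_sub_le_of_norm_hasDerivWithin_le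
    (f := fun t : ℝ => f t - t * f' x) (f' := fun t => f' t - 1 * f' x)
    (fun s _ => ((hf s).sub ((HasDerivAt.ofReal_comp (hasDerivAt_id s)).mul_const
      (f' x))).hasDerivWithinAt)
    (fun s hs => by simpa using h1 s hs)
    (Set.left_mem_Icc.2 (by linarith)) (Set.right_mem_Icc.2 (by linarith))
  have h3 : f' x = f (x + 1) - f x -
      ((f (x + 1) - ((x + 1 : ℝ) : ℂ) * f' x) - (f x - x * f' x)) := by
    push_cast; ring
  rw [h3]
  refine (norm_sub_le _ _).trans ?_
  have h4 := (norm_sub_le (f (x + 1)) (f x)).trans (add_le_add (hA _) (hA _))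
  simp only [add_sub_cancel_left, norm_one, mul_one] at h2
  linarith

/-- Moving two derivatives from the Poisson kernel to the other factor of a convolution. -/
lemma integral_mul_poissonDeriv_two {f f' f'' : ℝ → ℂ} {A B : ℝ}
    (hf : ∀ x, HasDerivAt f (f' x) x) (hf' : ∀ x, HasDerivAt f' (f'' x) x)
    (hc : Continuous f'') (hA : ∀ x, ‖f x‖ ≤ A) (hB : ∀ x, ‖f'' x‖ ≤ B)
    {y : ℝ} (hy : 0 < y) (x : ℝ) :
    ∫ t, f t * poissonDeriv 2 y (x - t) = ∫ t, f'' t * poissonDeriv 0 y (x - t) := by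
  have hint {g : ℝ → ℂ} {C : ℝ} (hg : Continuous g) (hC : ∀ x, ‖g x‖ ≤ C) (n : ℕ) :
      Integrable fun t => g t * poissonDeriv n y (x - t) :=
    ((integrable_poissonDeriv hy n).comp_sub_left x).bdd_mul hg.aestronglyMeasurable
      (Eventually.of_forall hC)
  have hC := norm_deriv_le_of_norm_le_of_norm_deriv_two_le hf hf' hA hB
  have hfc : Continuous f := continuous_iff_continuousAt.2 fun x => (hf x).continuousAt
  have hfc' : Continuous f' := continuous_iff_continuousAt.2 fun x => (hf' x).continuousAt
  have hk (n : ℕ) (t : ℝ) : HasDerivAt (fun t => poissonDeriv n y (x - t))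
      (-poissonDeriv (n + 1) y (x - t)) t :=
    (hasDerivAt_poissonDeriv hy n (x - t)).comp_const_sub x t
  have hparts {g g' : ℝ → ℂ} {C C' : ℝ} (hg : ∀ x, HasDerivAt g (g' x) x) (hgc : Continuous g)
      (hgc' : Continuous g') (hC : ∀ x, ‖g x‖ ≤ C) (hC' : ∀ x, ‖g' x‖ ≤ C') (n : ℕ) :
      ∫ t, g t * poissonDeriv (n + 1) y (x - t) = ∫ t, g' t * poissonDeriv n y (x - t) := by
    have h := integral_mul_deriv_eq_deriv_mul_of_integrable (fun t _ => hg t)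
      (fun t _ => hk n t)
      (by simpa [Pi.mul_def] using (hint hgc hC (n + 1)).neg) (hint hgc' hC' n) (hint hgc hC n)
    simpa [integral_neg] using h
  rw [hparts hf hfc hfc' hA hC, hparts hf' hfc' hc hC hB]

/-- Integrals of functions valued in a closed subspace stay in the subspace. -/
lemma Submodule.intervalIntegral_mem {E : Type*} [NormedAddCommGroup E] [NormedSpace ℂ E]
    [CompleteSpace E] {S : Submodule ℂ E} (hS : IsClosed (S : Set E)) {F : ℝ → E}
    (hF : Continuous F) (hmem : ∀ t, F t ∈ S) (a b : ℝ) : ∫ t in a..b, F t ∈ S := by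
  have : CompleteSpace S := hS.completeSpace_coe
  have hc : Continuous fun t => (⟨F t, hmem t⟩ : S) := hF.subtype_mk hmem
  have h := S.subtypeL.intervalIntegral_comp_comm (hc.intervalIntegrable (μ := volume) a b)
  exact h ▸ (∫ t in a..b, (⟨F t, hmem t⟩ : S)).2

/-- The pairs `(g, g'')` of bounded continuous functions with `g ∈ D` twice continuously
differentiable. -/
noncomputable def derivTwoGraph (D : Submodule ℂ (ℝ → ℂ)) :
    Submodule ℂ ((ℝ →ᵇ ℂ) × (ℝ →ᵇ ℂ)) where
  carrier := {p | ⇑p.1 ∈ D ∧ ContDiff ℝ 2 p.1 ∧ iteratedDeriv 2 p.1 = p.2}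
  zero_mem' := by
    refine ⟨D.zero_mem, contDiff_const (c := (0 : ℂ)), ?_⟩
    ext x
    simp
  add_mem' := by
    rintro p q ⟨hp, hp', hp''⟩ ⟨hq, hq', hq''⟩
    refine ⟨D.add_mem hp hq, hp'.add hq', funext fun x => ?_⟩
    simpa [hp'', hq''] using iteratedDeriv_add (n := 2) hp'.contDiffAt (hq'.contDiffAt (x := x))
  smul_mem' := by
    rintro c p ⟨hp, hp', hp''⟩
    refine ⟨D.smul_mem c hp, hp'.const_smul c, funext fun x => ?_⟩
    simp [hp'']

lemma poissonDeriv_zero_comp_sub_mem_span {y : ℝ} (hy : 0 < y) (t : ℝ) :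
    (fun x => poissonDeriv 0 y (x - t)) ∈ Submodule.span ℂ {g : ℝ → ℂ |
      ∃ z₁ z₂ : ℂ, z₁.im ≠ 0 ∧ z₂.im ≠ 0 ∧
        g = fun x : ℝ => (z₁ - (x : ℂ))⁻¹ - (z₂ - (x : ℂ))⁻¹} := by
  have h : (fun x => poissonDeriv 0 y (x - t)) = (2 * Real.pi * I : ℂ)⁻¹ •
      fun x : ℝ => ((t - y * I : ℂ) - x)⁻¹ - ((t + y * I : ℂ) - x)⁻¹ := by
    ext x
    simp only [poissonDeriv, Pi.smul_apply, smul_eq_mul, Nat.factorial_zero, Nat.cast_one,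
      mul_one, zero_add, pow_one]
    push_cast
    congr 3 <;> ring
  rw [h]
  refine Submodule.smul_mem _ _ (Submodule.subset_span ⟨_, _, ?_, ?_, rfl⟩) <;>
    simpa using hy.ne'

/-- The span `D` of differences of resolvent functions `x ↦ 1/(z₁-x) - 1/(z₂-x)`,
`z₁, z₂ ∈ ℂ ∖ ℝ`, is dense in
`W^∞ = {f : f twice continuously differentiable, f and f'' vanish at infinity}`
with respect to the norm `sup|f| + sup|f''|`. -/
theorem stmt_4
    (D : Submodule ℂ (ℝ → ℂ))
    (hD : D = Submodule.span ℂ {g : ℝ → ℂ |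
      ∃ z₁ z₂ : ℂ, z₁.im ≠ 0 ∧ z₂.im ≠ 0 ∧
        g = fun x : ℝ => (z₁ - (x : ℂ))⁻¹ - (z₂ - (x : ℂ))⁻¹})
    (f : ℝ → ℂ) (hf : ContDiff ℝ 2 f)
    (hf0 : Tendsto f (cocompact ℝ) (𝓝 0))
    (hf2 : Tendsto (iteratedDeriv 2 f) (cocompact ℝ) (𝓝 0))
    (ε : ℝ) (hε : 0 < ε) :
    ∃ g ∈ D, ∃ C₁ C₂ : ℝ,
      (∀ x : ℝ, ‖f x - g x‖ ≤ C₁) ∧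
      (∀ x : ℝ, ‖iteratedDeriv 2 f x - iteratedDeriv 2 g x‖ ≤ C₂) ∧
      C₁ + C₂ < ε := by
  have hc2 : Continuous (iteratedDeriv 2 f) := hf.continuous_iteratedDeriv 2 le_rfl
  have hd1 (x : ℝ) : HasDerivAt f (iteratedDeriv 1 f x) x := by
    rw [iteratedDeriv_one]
    exact (hf.differentiable (by norm_num) x).hasDerivAt
  have hd2 (x : ℝ) : HasDerivAt (iteratedDeriv 1 f) (iteratedDeriv 2 f x) x := by
    rw [iteratedDeriv_succ (n := 1)]
    exact (hf.differentiable_iteratedDeriv 1 (by norm_num) x).hasDerivAt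
  obtain ⟨f₀, hf₀, hu₀⟩ := exists_boundedContinuousFunction_of_tendsto_cocompact hf.continuous hf0
  obtain ⟨f₂, hf₂, hu₂⟩ := exists_boundedContinuousFunction_of_tendsto_cocompact hc2 hf2
  have hε8 : 0 < ε / 8 := by positivity
  obtain ⟨y, ⟨hy₀, hy₂⟩, hy : 0 < y⟩ :=
    (((eventually_norm_integral_poisson_sub_le hu₀ hε8).and
      (eventually_norm_integral_poisson_sub_le hu₂ hε8)).and self_mem_nhdsWithin).exists
  simp only [hf₀] at hy₀
  simp only [hf₂, ← integral_mul_poissonDeriv_two hd1 hd2 hc2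
    (fun x => hf₀ ▸ f₀.norm_coe_le_norm x) (fun x => hf₂ ▸ f₂.norm_coe_le_norm x) hy] at hy₂
  obtain ⟨R, hR₀, hR₂⟩ :=
    ((eventually_norm_intervalIntegral_sub_integral_le hf.continuous hf0
      (integrable_poissonDeriv hy 0) hε8).and
    (eventually_norm_intervalIntegral_sub_integral_le hf.continuous hf0
      (integrable_poissonDeriv hy 2) hε8)).exists
  obtain ⟨k₀, hk₀, hku₀⟩ := exists_boundedContinuousFunction_of_tendsto_cocompact
    (continuous_poissonDeriv hy 0) (tendsto_poissonDeriv_cocompact 0 y)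
  obtain ⟨k₂, hk₂, hku₂⟩ := exists_boundedContinuousFunction_of_tendsto_cocompact
    (continuous_poissonDeriv hy 2) (tendsto_poissonDeriv_cocompact 2 y)
  let F : ℝ → (ℝ →ᵇ ℂ) × (ℝ →ᵇ ℂ) := fun t => f t • (k₀.translate t, k₂.translate t)
  have hF : Continuous F := hf.continuous.smul
    ((continuous_translate hku₀).prodMk (continuous_translate hku₂))
  have hmem (t : ℝ) : F t ∈ (derivTwoGraph D).topologicalClosure := by
    refine Submodule.smul_mem _ _ (Submodule.le_topologicalClosure _ ?_)
    have h₀ : ⇑(k₀.translate t) = fun x => poissonDeriv 0 y (x - t) := by ext x; simp [hk₀]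
    have h₂ : ⇑(k₂.translate t) = fun x => poissonDeriv 2 y (x - t) := by ext x; simp [hk₂]
    refine ⟨?_, ?_, ?_⟩
    · simpa only [h₀, hD] using poissonDeriv_zero_comp_sub_mem_span hy t
    · simpa only [h₀] using contDiff_two_poissonDeriv_comp_sub hy 0 t
    · simpa only [h₀, h₂] using iteratedDeriv_two_poissonDeriv_comp_sub hy t
  have hJ := Submodule.intervalIntegral_mem
    (derivTwoGraph D).isClosed_topologicalClosure hF hmem (-R) R
  have hJ₀ (x : ℝ) : (∫ t in (-R)..R, F t).1 x =
      ∫ t in (-R)..R, f t * poissonDeriv 0 y (x - t) := by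
    have h := ((evalCLM ℂ x : (ℝ →ᵇ ℂ) →L[ℂ] ℂ).comp
      (ContinuousLinearMap.fst ℂ _ (ℝ →ᵇ ℂ))).intervalIntegral_comp_comm
        (hF.intervalIntegrable (μ := volume) (-R) R)
    simpa [F, hk₀] using h.symm
  have hJ₂ (x : ℝ) : (∫ t in (-R)..R, F t).2 x =
      ∫ t in (-R)..R, f t * poissonDeriv 2 y (x - t) := by
    have h := ((evalCLM ℂ x : (ℝ →ᵇ ℂ) →L[ℂ] ℂ).comp
      (ContinuousLinearMap.snd ℂ (ℝ →ᵇ ℂ) _)).intervalIntegral_comp_comm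
        (hF.intervalIntegrable (μ := volume) (-R) R)
    simpa [F, hk₂] using h.symm
  obtain ⟨⟨g, g₂⟩, ⟨hgD, -, hg₂⟩, hdist⟩ := Metric.mem_closure_iff.1 hJ (ε / 8) hε8
  rw [Prod.dist_eq, max_lt_iff] at hdist
  refine ⟨g, hgD, 3 * (ε / 8), 3 * (ε / 8), fun x => ?_, fun x => ?_, by linarith⟩
  · have h := ((dist_coe_le_dist x).trans_lt hdist.1).le
    rw [hJ₀, dist_eq_norm] at h
    have h' := norm_add₃_le.trans (add_le_add (add_le_add (hy₀ x) (hR₀ x)) h)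
    rw [sub_add_sub_cancel, sub_add_sub_cancel] at h'
    linarith
  · have h := ((dist_coe_le_dist x).trans_lt hdist.2).le
    rw [hJ₂, dist_eq_norm] at h
    have h' := norm_add₃_le.trans (add_le_add (add_le_add (hy₂ x) (hR₂ x)) h)
    rw [sub_add_sub_cancel, sub_add_sub_cancel] at h'
    simp only at hg₂
    rw [hg₂]
    linarith
end

section
/- Let μ be a Borel probability measure on ℝ with finite second moment, mean α = ∫x dμ(x) and variance β = ∫(x−α)² dμ(x) > 0, and let ν be a Borel probability measure such that 1/G_μ(z) = z − α − β·G_ν(z) for all z ∈ ℂ∖ℝ. Then for all z, w ∈ ℂ∖ℝ: ∫_ℝ (1/(z−x) − G_μ(z)) · conj(1/(w−x) − G_μ(w)) dμ(x) = β · G_μ(z) · conj(G_μ(w)) · ∫_ℝ (1/(z−x)) · conj(1/(w−x)) dν(x). Equivalently, since L_μ[1/(z−·)](x) = G_μ(z)/(z−x), the map f ↦ √β·L_μ f is isometric from the span of the centered resolvents {1/(z−·) − G_μ(z)} ⊆ L²(μ) into L²(ν). -/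
open MeasureTheory Filter Topology

lemma norm_inv_sub_ofReal_le {v : ℂ} (hv : v.im ≠ 0) (x : ℝ) :
    ‖(v - (x : ℂ))⁻¹‖ ≤ |v.im|⁻¹ := by
  rw [norm_inv]
  refine inv_anti₀ (abs_pos.mpr hv) ?_
  simpa using Complex.abs_im_le_norm (v - (x : ℂ))

lemma sub_ofReal_ne_zero {v : ℂ} (hv : v.im ≠ 0) (x : ℝ) : v - (x : ℂ) ≠ 0 := by
  intro h
  apply hv
  simpa using congrArg Complex.im h

lemma measurable_inv_sub_ofReal (v : ℂ) : Measurable fun x : ℝ => (v - (x : ℂ))⁻¹ := by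
  fun_prop

lemma integrable_inv_sub_ofReal_s12 (μ : Measure ℝ) [IsFiniteMeasure μ] {v : ℂ} (hv : v.im ≠ 0) :
    Integrable (fun x : ℝ => (v - (x : ℂ))⁻¹) μ :=
  Integrable.of_bound (measurable_inv_sub_ofReal v).aestronglyMeasurable _
    (Eventually.of_forall (norm_inv_sub_ofReal_le hv))

lemma integrable_inv_sub_mul_inv_sub (μ : Measure ℝ) [IsFiniteMeasure μ] {z v : ℂ}
    (hz : z.im ≠ 0) (hv : v.im ≠ 0) :
    Integrable (fun x : ℝ => (z - (x : ℂ))⁻¹ * (v - (x : ℂ))⁻¹) μ :=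
  (integrable_inv_sub_ofReal_s12 μ hv).bdd_mul
    (measurable_inv_sub_ofReal z).aestronglyMeasurable
    (Eventually.of_forall (norm_inv_sub_ofReal_le hz))

lemma cauchyTransform_ne_zero (μ : Measure ℝ) [IsProbabilityMeasure μ] {z : ℂ}
    (hz : z.im ≠ 0) : ∫ x : ℝ, (z - (x : ℂ))⁻¹ ∂μ ≠ 0 := by
  intro h
  have hint := integrable_inv_sub_ofReal_s12 μ hz
  have him : ∫ x : ℝ, (Complex.normSq (z - (x : ℂ)))⁻¹ ∂μ = 0 := by
    have h1 : ∫ x : ℝ, ((z - (x : ℂ))⁻¹).im ∂μ = 0 := by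
      have := integral_im (𝕜 := ℂ) hint
      rw [h] at this
      simpa using this
    have h2 : ∀ x : ℝ, ((z - (x : ℂ))⁻¹).im
        = -z.im * (Complex.normSq (z - (x : ℂ)))⁻¹ := by
      intro x
      simp [Complex.inv_im, div_eq_mul_inv]
    simp_rw [h2] at h1
    rw [integral_const_mul] at h1
    exact (mul_eq_zero.mp h1).resolve_left (neg_ne_zero.mpr hz)
  have hpos : ∀ x : ℝ, 0 < (Complex.normSq (z - (x : ℂ)))⁻¹ := fun x =>
    inv_pos.mpr (Complex.normSq_pos.mpr (sub_ofReal_ne_zero hz x))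
  have hI : Integrable (fun x : ℝ => (Complex.normSq (z - (x : ℂ)))⁻¹) μ := by
    refine ((integrable_inv_sub_mul_inv_sub μ hz hz).norm).congr (Eventually.of_forall fun x => ?_)
    simp [Complex.normSq_eq_norm_sq, sq]
  have h0 := (integral_eq_zero_iff_of_nonneg (fun x => (hpos x).le) hI).mp him
  obtain ⟨x, hx⟩ := h0.exists
  exact (hpos x).ne' hx

lemma continuousAt_integral_mul_inv_sub (μ : Measure ℝ) [IsFiniteMeasure μ] {f : ℝ → ℂ}
    (hf : Integrable f μ) {v : ℂ} (hv : v.im ≠ 0) :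
    ContinuousAt (fun v : ℂ => ∫ x : ℝ, f x * (v - (x : ℂ))⁻¹ ∂μ) v := by
  have hev : ∀ᶠ u : ℂ in 𝓝 v, |v.im| / 2 < |u.im| :=
    (Complex.continuous_im.abs.continuousAt (x := v)).eventually_const_lt
      (half_lt_self (abs_pos.mpr hv))
  have hv2 : 0 < |v.im| / 2 := half_pos (abs_pos.mpr hv)
  refine continuousAt_of_dominated (bound := fun x => ‖f x‖ * (|v.im| / 2)⁻¹) ?_ ?_ ?_ ?_
  · exact Eventually.of_forall fun u =>
      hf.aestronglyMeasurable.mul (measurable_inv_sub_ofReal u).aestronglyMeasurable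
  · filter_upwards [hev] with u hu
    refine Eventually.of_forall fun x => ?_
    rw [norm_mul]
    gcongr
    exact (norm_inv_sub_ofReal_le (abs_pos.mp (hv2.trans hu)) x).trans (inv_anti₀ hv2 hu.le)
  · exact hf.norm.mul_const _
  · refine Eventually.of_forall fun x => ?_
    exact continuousAt_const.mul
      ((continuousAt_id.sub continuousAt_const).inv₀ (sub_ofReal_ne_zero hv x))

lemma integral_inv_sub_mul_inv_sub (μ : Measure ℝ) [IsFiniteMeasure μ] {z v : ℂ}
    (hz : z.im ≠ 0) (hv : v.im ≠ 0) (hzv : v ≠ z) :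
    ∫ x : ℝ, (z - (x : ℂ))⁻¹ * (v - (x : ℂ))⁻¹ ∂μ
      = (∫ x : ℝ, (z - (x : ℂ))⁻¹ ∂μ - ∫ x : ℝ, (v - (x : ℂ))⁻¹ ∂μ) / (v - z) := by
  rw [← integral_sub (integrable_inv_sub_ofReal_s12 μ hz) (integrable_inv_sub_ofReal_s12 μ hv),
    ← integral_div]
  congr 1
  ext x
  have h1 := sub_ofReal_ne_zero hz x
  have h2 := sub_ofReal_ne_zero hv x
  have h3 := sub_ne_zero.mpr hzv
  field_simp
  ring

/-- The bilinear form of the resolvent identity, including the diagonal `v = z`. -/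
lemma resolvent_identity (μ ν : Measure ℝ) [IsProbabilityMeasure μ] [IsProbabilityMeasure ν]
    (α β : ℂ)
    (hstrip : ∀ z : ℂ, z.im ≠ 0 →
      (∫ x : ℝ, (z - (x : ℂ))⁻¹ ∂μ)⁻¹ = z - α - β * ∫ x : ℝ, (z - (x : ℂ))⁻¹ ∂ν)
    {z v : ℂ} (hz : z.im ≠ 0) (hv : v.im ≠ 0) :
    ∫ x : ℝ, (z - (x : ℂ))⁻¹ * (v - (x : ℂ))⁻¹ ∂μ
        - (∫ x : ℝ, (z - (x : ℂ))⁻¹ ∂μ) * ∫ x : ℝ, (v - (x : ℂ))⁻¹ ∂μ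
      = β * (∫ x : ℝ, (z - (x : ℂ))⁻¹ ∂μ) * (∫ x : ℝ, (v - (x : ℂ))⁻¹ ∂μ) *
          ∫ x : ℝ, (z - (x : ℂ))⁻¹ * (v - (x : ℂ))⁻¹ ∂ν := by
  have key : ∀ u : ℂ, u.im ≠ 0 → u ≠ z →
      ∫ x : ℝ, (z - (x : ℂ))⁻¹ * (u - (x : ℂ))⁻¹ ∂μ
        - (∫ x : ℝ, (z - (x : ℂ))⁻¹ ∂μ) * ∫ x : ℝ, (u - (x : ℂ))⁻¹ ∂μ
      = β * (∫ x : ℝ, (z - (x : ℂ))⁻¹ ∂μ) * (∫ x : ℝ, (u - (x : ℂ))⁻¹ ∂μ) *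
          ∫ x : ℝ, (z - (x : ℂ))⁻¹ * (u - (x : ℂ))⁻¹ ∂ν := by
    intro u hu huz
    rw [integral_inv_sub_mul_inv_sub μ hz hu huz, integral_inv_sub_mul_inv_sub ν hz hu huz]
    have h1 := hstrip z hz
    have h2 := hstrip u hu
    have g1 := cauchyTransform_ne_zero μ hz
    have g2 := cauchyTransform_ne_zero μ hu
    have h3 := sub_ne_zero.mpr huz
    generalize (∫ x : ℝ, (z - (x : ℂ))⁻¹ ∂μ) = a at *
    generalize (∫ x : ℝ, (u - (x : ℂ))⁻¹ ∂μ) = b at *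
    generalize (∫ x : ℝ, (z - (x : ℂ))⁻¹ ∂ν) = c at *
    generalize (∫ x : ℝ, (u - (x : ℂ))⁻¹ ∂ν) = d at *
    field_simp at h1 h2 ⊢
    linear_combination a * h2 - b * h1
  rcases ne_or_eq v z with hne | rfl
  · exact key v hv hne
  have hcont (ρ : Measure ℝ) [IsProbabilityMeasure ρ] :=
    continuousAt_integral_mul_inv_sub ρ (integrable_inv_sub_ofReal_s12 ρ hv) hv
  have hG : ContinuousAt (fun u : ℂ => ∫ x : ℝ, (u - (x : ℂ))⁻¹ ∂μ) v := by
    simpa using continuousAt_integral_mul_inv_sub μ (integrable_const (1 : ℂ)) hv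
  have hl := (hcont μ).sub (hG.const_mul (∫ x : ℝ, (v - (x : ℂ))⁻¹ ∂μ))
  have hr := (hG.const_mul (β * ∫ x : ℝ, (v - (x : ℂ))⁻¹ ∂μ)).mul (hcont ν)
  refine tendsto_nhds_unique_of_eventuallyEq (hl.tendsto.mono_left nhdsWithin_le_nhds)
    (hr.tendsto.mono_left nhdsWithin_le_nhds) (l := 𝓝[≠] v) ?_
  have him : ∀ᶠ u : ℂ in 𝓝[≠] v, u.im ≠ 0 :=
    nhdsWithin_le_nhds (Complex.continuous_im.continuousAt.eventually_ne hv)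
  filter_upwards [him, self_mem_nhdsWithin] with u hu hne
  exact key u hu hne

lemma conj_inv_sub_ofReal (w : ℂ) (x : ℝ) :
    (starRingEnd ℂ) ((w - (x : ℂ))⁻¹) = ((starRingEnd ℂ) w - (x : ℂ))⁻¹ := by
  simp

/-- The key inner-product identity for coefficient stripping: if `μ` has mean `α` and
variance `β > 0`, and `ν` satisfies `1/G_μ(z) = z - α - β G_ν(z)`, then for
`z, w ∈ ℂ ∖ ℝ`,
`∫ (1/(z-x) - G_μ(z)) conj(1/(w-x) - G_μ(w)) dμ(x)
  = β G_μ(z) conj(G_μ(w)) ∫ (1/(z-x)) conj(1/(w-x)) dν(x)`. -/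
theorem stmt_12 (μ ν : Measure ℝ) [IsProbabilityMeasure μ] [IsProbabilityMeasure ν]
    (hmom : Integrable (fun x => x ^ 2) μ)
    (α β : ℝ) (hα : α = ∫ x, x ∂μ) (hβ : β = ∫ x, (x - α) ^ 2 ∂μ) (hβ0 : 0 < β)
    (hstrip : ∀ z : ℂ, z.im ≠ 0 →
      (∫ x, (z - (x : ℂ))⁻¹ ∂μ)⁻¹
        = z - (α : ℂ) - (β : ℂ) * ∫ x, (z - (x : ℂ))⁻¹ ∂ν)
    (z w : ℂ) (hz : z.im ≠ 0) (hw : w.im ≠ 0) :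
    ∫ x, ((z - (x : ℂ))⁻¹ - ∫ u, (z - (u : ℂ))⁻¹ ∂μ) *
        (starRingEnd ℂ) ((w - (x : ℂ))⁻¹ - ∫ u, (w - (u : ℂ))⁻¹ ∂μ) ∂μ
      = (β : ℂ) * (∫ u, (z - (u : ℂ))⁻¹ ∂μ) *
          (starRingEnd ℂ) (∫ u, (w - (u : ℂ))⁻¹ ∂μ) *
          ∫ x, (z - (x : ℂ))⁻¹ * (starRingEnd ℂ) ((w - (x : ℂ))⁻¹) ∂ν := by
  have hv : ((starRingEnd ℂ) w).im ≠ 0 := by simpa using hw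
  have hG : (starRingEnd ℂ) (∫ u, (w - (u : ℂ))⁻¹ ∂μ)
      = ∫ u : ℝ, ((starRingEnd ℂ) w - (u : ℂ))⁻¹ ∂μ := by
    rw [← integral_conj]
    simp_rw [conj_inv_sub_ofReal]
  simp_rw [map_sub (starRingEnd ℂ) ((w - _)⁻¹), hG, conj_inv_sub_ofReal]
  rw [← resolvent_identity μ ν α β hstrip hz hv]
  have i1 := integrable_inv_sub_ofReal_s12 μ hz
  have i2 := integrable_inv_sub_ofReal_s12 μ hv
  have i3 := integrable_inv_sub_mul_inv_sub μ hz hv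
  set v := (starRingEnd ℂ) w
  set a := ∫ u : ℝ, (z - (u : ℂ))⁻¹ ∂μ with ha
  set b := ∫ u : ℝ, (v - (u : ℂ))⁻¹ ∂μ with hb
  have hexp : ∀ x : ℝ, ((z - (x : ℂ))⁻¹ - a) * ((v - (x : ℂ))⁻¹ - b)
      = (z - (x : ℂ))⁻¹ * (v - (x : ℂ))⁻¹ - (z - (x : ℂ))⁻¹ * b
        - (a * (v - (x : ℂ))⁻¹ - a * b) := fun x => by ring
  simp_rw [hexp]
  have j1 : Integrable (fun x : ℝ => (z - (x : ℂ))⁻¹ * (v - (x : ℂ))⁻¹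
      - (z - (x : ℂ))⁻¹ * b) μ := i3.sub (i1.mul_const b)
  have j2 : Integrable (fun x : ℝ => a * (v - (x : ℂ))⁻¹ - a * b) μ :=
    (i2.const_mul a).sub (integrable_const _)
  rw [integral_sub j1 j2, integral_sub i3 (i1.mul_const b),
    integral_sub (i2.const_mul a) (integrable_const _),
    integral_mul_const, integral_const_mul, ← ha, ← hb]
  simp
end

section
/- Let ν be a finite positive Borel measure on ℝ, α ∈ ℝ, and define A f(x) = α f'(x) + ∫_ℝ (f(y) − f(x) − (y−x)f'(x))/(y−x)² dν(y) for twice differentiable f with bounded second derivative. Then for all bounded, twice continuously differentiable f, g : ℝ → ℂ with bounded first and second derivatives, and every x ∈ ℝ: A(fg)(x) − f(x)·A(g)(x) − A(f)(x)·g(x) = ∫_ℝ ((f(x) − f(y))(g(x) − g(y)))/(x−y)² dν(y). That is, the carré du champ operator of A is Γ(f,g)(x) = ∫_ℝ (∂f)(x,y)(∂g)(x,y) dν(y), where (∂f)(x,y) = (f(x) − f(y))/(x−y), independently of α. -/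
open MeasureTheory

/-- The generator `A = α ∂_x + ∂_x L_ν` of a free Lévy process of the first kind:
`A f(x) = α f'(x) + ∫ (f(y) - f(x) - (y-x) f'(x)) / (y-x)² dν(y)`. -/
noncomputable def freeGen (ν : Measure ℝ) (α : ℝ) (f : ℝ → ℂ) (x : ℝ) : ℂ :=
  (α : ℂ) * deriv f x +
    ∫ y, (f y - f x - ((y - x : ℝ) : ℂ) * deriv f x) / ((y - x : ℝ) : ℂ) ^ 2 ∂ν

/-- First-order Taylor bound for a function whose second derivative is bounded. -/
lemma norm_sub_sub_deriv_le {f : ℝ → ℂ} (hf : ContDiff ℝ 2 f) {C : ℝ}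
    (hC : ∀ x, ‖deriv (deriv f) x‖ ≤ C) (x y : ℝ) :
    ‖f y - f x - ((y - x : ℝ) : ℂ) * deriv f x‖ ≤ C * |y - x| ^ 2 := by
  have hC0 : 0 ≤ C := (norm_nonneg _).trans (hC 0)
  have hd : Differentiable ℝ f := hf.differentiable (by norm_num)
  have hd' : Differentiable ℝ (deriv f) := by
    have h : ContDiff ℝ (1 + 1) f := by simpa [one_add_one_eq_two] using hf
    exact (contDiff_succ_iff_deriv.1 h).2.2.differentiable (by norm_num)
  have hlip : ∀ u, ‖deriv f u - deriv f x‖ ≤ C * ‖u - x‖ := fun u =>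
    convex_univ.norm_image_sub_le_of_norm_deriv_le (fun z _ => hd' z) (fun z _ => hC z)
      (Set.mem_univ x) (Set.mem_univ u)
  have hderiv : ∀ u ∈ Set.uIcc x y, HasDerivWithinAt (fun u : ℝ => f u - (u : ℂ) * deriv f x)
      (deriv f u - deriv f x) (Set.uIcc x y) u := by
    intro u _
    have h := (hd u).hasDerivAt.fun_sub ((Complex.ofRealCLM.hasDerivAt (x := u)).mul_const (deriv f x))
    simpa using h.hasDerivWithinAt
  have hbound : ∀ u ∈ Set.uIcc x y, ‖deriv f u - deriv f x‖ ≤ C * |y - x| := fun u hu =>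
    (hlip u).trans (mul_le_mul_of_nonneg_left (Set.abs_sub_left_of_mem_uIcc hu) hC0)
  have h := (convex_uIcc x y).norm_image_sub_le_of_norm_hasDerivWithin_le hderiv hbound
    Set.left_mem_uIcc Set.right_mem_uIcc
  rw [Real.norm_eq_abs] at h
  calc ‖f y - f x - ((y - x : ℝ) : ℂ) * deriv f x‖
      = ‖f y - (y : ℂ) * deriv f x - (f x - (x : ℂ) * deriv f x)‖ := by
        congr 1; push_cast; ring
    _ ≤ C * |y - x| * |y - x| := h
    _ = C * |y - x| ^ 2 := by ring

/-- A continuous function vanishing quadratically at `x` stays integrable against a finite measure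
after division by `(y - x)²`. -/
lemma integrable_div_sub_sq (ν : Measure ℝ) [IsFiniteMeasure ν] {N : ℝ → ℂ} (hN : Continuous N)
    {C x : ℝ} (hC : ∀ y, ‖N y‖ ≤ C * |y - x| ^ 2) :
    Integrable (fun y => N y / ((y - x : ℝ) : ℂ) ^ 2) ν := by
  have hC0 : 0 ≤ C := by simpa using (norm_nonneg _).trans (hC (x + 1))
  have hm : Measurable (fun y : ℝ => N y / ((y - x : ℝ) : ℂ) ^ 2) :=
    hN.measurable.div (by fun_prop)
  refine Integrable.of_bound hm.aestronglyMeasurable C (ae_of_all _ fun y => ?_)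
  rw [norm_div, norm_pow, Complex.norm_real, Real.norm_eq_abs]
  exact div_le_of_le_mul₀ (by positivity) hC0 (hC y)

/-- The integral part of `freeGen` converges for functions with bounded second derivative. -/
lemma integrable_freeGen_integrand (ν : Measure ℝ) [IsFiniteMeasure ν] {f : ℝ → ℂ}
    (hf : ContDiff ℝ 2 f) (hf2 : ∃ C, ∀ x, ‖deriv (deriv f) x‖ ≤ C) (x : ℝ) :
    Integrable
      (fun y => (f y - f x - ((y - x : ℝ) : ℂ) * deriv f x) / ((y - x : ℝ) : ℂ) ^ 2) ν := by
  obtain ⟨C, hC⟩ := hf2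
  have hc := hf.continuous
  exact integrable_div_sub_sq ν (by fun_prop) (norm_sub_sub_deriv_le hf hC x)

/-- The product of difference quotients of Lipschitz functions is integrable. -/
lemma integrable_mul_differenceQuotient (ν : Measure ℝ) [IsFiniteMeasure ν] {f g : ℝ → ℂ}
    (hf : Differentiable ℝ f) (hg : Differentiable ℝ g)
    (hf1 : ∃ C, ∀ x, ‖deriv f x‖ ≤ C) (hg1 : ∃ C, ∀ x, ‖deriv g x‖ ≤ C) (x : ℝ) :
    Integrable (fun y => ((f x - f y) * (g x - g y)) / ((y - x : ℝ) : ℂ) ^ 2) ν := by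
  obtain ⟨C, hC⟩ := hf1
  obtain ⟨D, hD⟩ := hg1
  have hfc := hf.continuous
  have hgc := hg.continuous
  refine integrable_div_sub_sq ν (C := C * D) (by fun_prop) fun y => ?_
  have h1 : ‖f x - f y‖ ≤ C * ‖x - y‖ := convex_univ.norm_image_sub_le_of_norm_deriv_le
    (fun z _ => hf z) (fun z _ => hC z) (Set.mem_univ y) (Set.mem_univ x)
  have h2 : ‖g x - g y‖ ≤ D * ‖x - y‖ := convex_univ.norm_image_sub_le_of_norm_deriv_le
    (fun z _ => hg z) (fun z _ => hD z) (Set.mem_univ y) (Set.mem_univ x)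
  rw [norm_mul, abs_sub_comm, ← Real.norm_eq_abs]
  calc ‖f x - f y‖ * ‖g x - g y‖ ≤ (C * ‖x - y‖) * (D * ‖x - y‖) :=
        mul_le_mul h1 h2 (norm_nonneg _) ((norm_nonneg _).trans h1)
    _ = C * D * ‖x - y‖ ^ 2 := by ring

/-- Carré du champ identity for `A = α ∂_x + ∂_x L_ν`:
`A(fg) - f·A(g) - A(f)·g = ∫ (f(x)-f(y))(g(x)-g(y))/(x-y)² dν(y)`, independently of `α`. -/
theorem stmt_14 (ν : Measure ℝ) [IsFiniteMeasure ν] (α : ℝ) (f g : ℝ → ℂ)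
    (hfb : ∃ C, ∀ x, ‖f x‖ ≤ C) (hgb : ∃ C, ∀ x, ‖g x‖ ≤ C)
    (hf : ContDiff ℝ 2 f) (hg : ContDiff ℝ 2 g)
    (hf1 : ∃ C, ∀ x, ‖deriv f x‖ ≤ C) (hf2 : ∃ C, ∀ x, ‖deriv (deriv f) x‖ ≤ C)
    (hg1 : ∃ C, ∀ x, ‖deriv g x‖ ≤ C) (hg2 : ∃ C, ∀ x, ‖deriv (deriv g) x‖ ≤ C)
    (x : ℝ) :
    freeGen ν α (fun u => f u * g u) x - f x * freeGen ν α g x - freeGen ν α f x * g x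
      = ∫ y, ((f x - f y) * (g x - g y)) / ((x - y : ℝ) : ℂ) ^ 2 ∂ν := by
  have hfd : Differentiable ℝ f := hf.differentiable (by norm_num)
  have hgd : Differentiable ℝ g := hg.differentiable (by norm_num)
  have hF := integrable_freeGen_integrand ν hf hf2 x
  have hG := integrable_freeGen_integrand ν hg hg2 x
  have hP := integrable_mul_differenceQuotient ν hfd hgd hf1 hg1 x
  have hsq : ∀ y : ℝ, ((x - y : ℝ) : ℂ) ^ 2 = ((y - x : ℝ) : ℂ) ^ 2 := fun y => by
    push_cast; ring
  have hderiv : deriv (fun u => f u * g u) x = deriv f x * g x + f x * deriv g x :=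
    deriv_fun_mul (hfd x) (hgd x)
  have hsplit : ∀ y : ℝ,
      (f y * g y - f x * g x - ((y - x : ℝ) : ℂ) * (deriv f x * g x + f x * deriv g x))
          / ((y - x : ℝ) : ℂ) ^ 2
        = f x * ((g y - g x - ((y - x : ℝ) : ℂ) * deriv g x) / ((y - x : ℝ) : ℂ) ^ 2)
          + (f y - f x - ((y - x : ℝ) : ℂ) * deriv f x) / ((y - x : ℝ) : ℂ) ^ 2 * g x
          + ((f x - f y) * (g x - g y)) / ((y - x : ℝ) : ℂ) ^ 2 := fun y => by
    ring
  simp only [freeGen, hderiv, hsq, hsplit]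
  rw [integral_add ((hG.const_mul _).fun_add (hF.mul_const _)) hP,
    integral_add (hG.const_mul _) (hF.mul_const _), integral_const_mul, integral_mul_const]
  ring
end

section
/- Let ν be a finite positive Borel measure on ℝ, α ∈ ℝ, and define A f(x) = α f'(x) + ∫_ℝ (f(y) − f(x) − (y−x)f'(x))/(y−x)² dν(y). Let f : ℝ → ℂ be twice differentiable with bounded second derivative, and suppose x₀ ∈ ℝ satisfies |f(x₀)| = sup_{x ∈ ℝ} |f(x)|. Then Re( conj(f(x₀)) · A f(x₀) ) ≤ 0. (Hence A is dissipative on C_0(ℝ) in the sense of normalized tangent functionals.) -/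
open MeasureTheory

open ComplexConjugate in
lemma re_conj_mul_le_of_norm_le {z w : ℂ} (h : ‖w‖ ≤ ‖z‖) :
    (conj z * w).re ≤ (conj z * z).re := by
  calc (conj z * w).re ≤ ‖conj z * w‖ := Complex.re_le_norm _
    _ = ‖z‖ * ‖w‖ := by rw [norm_mul, RCLike.norm_conj]
    _ ≤ ‖z‖ * ‖z‖ := by gcongr
    _ = (conj z * z).re := by
      rw [Complex.conj_mul', ← Complex.ofReal_pow, Complex.ofReal_re, sq]

open ComplexConjugate in
lemma re_conj_mul_deriv_eq_zero {f : ℝ → ℂ} {x₀ : ℝ} (hf : DifferentiableAt ℝ f x₀)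
    (hmax : ∀ x, ‖f x‖ ≤ ‖f x₀‖) : (conj (f x₀) * deriv f x₀).re = 0 := by
  have hderiv : HasDerivAt (fun x => (conj (f x₀) * f x).re) (conj (f x₀) * deriv f x₀).re x₀ :=
    Complex.reCLM.hasFDerivAt.comp_hasDerivAt x₀ (hf.hasDerivAt.const_mul _)
  have hloc : IsLocalMax (fun x => (conj (f x₀) * f x).re) x₀ :=
    Filter.Eventually.of_forall fun x => re_conj_mul_le_of_norm_le (hmax x)
  exact hloc.hasDerivAt_eq_zero hderiv

/-- `C₀`-dissipativity of `A = α ∂_x + ∂_x L_ν`: if `|f|` attains its supremum at `x₀`,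
then `Re( conj(f(x₀)) · A f(x₀) ) ≤ 0`. -/
theorem stmt_17 (ν : Measure ℝ) [IsFiniteMeasure ν] (α : ℝ) (f : ℝ → ℂ)
    (hf1 : Differentiable ℝ f) (hf2 : Differentiable ℝ (deriv f))
    (hbdd : ∃ C, ∀ u, ‖deriv (deriv f) u‖ ≤ C)
    (x₀ : ℝ) (hmax : ∀ x, ‖f x‖ ≤ ‖f x₀‖) :
    ((starRingEnd ℂ) (f x₀) * freeGen ν α f x₀).re ≤ 0 := by
  unfold freeGen
  set c := (starRingEnd ℂ) (f x₀)
  have hd : (c * deriv f x₀).re = 0 := re_conj_mul_deriv_eq_zero (hf1 x₀) hmax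
  have hdrift : (c * ((α : ℂ) * deriv f x₀)).re = 0 := by
    rw [mul_left_comm, Complex.re_ofReal_mul, hd, mul_zero]
  rw [mul_add, Complex.add_re, hdrift, zero_add]
  by_cases hint : Integrable (fun y => (f y - f x₀ - ((y - x₀ : ℝ) : ℂ) * deriv f x₀) /
      ((y - x₀ : ℝ) : ℂ) ^ 2) ν
  · rw [← integral_const_mul]
    refine (integral_re (hint.const_mul c)).symm.trans_le (integral_nonpos fun y => ?_)
    change (c * ((f y - f x₀ - ((y - x₀ : ℝ) : ℂ) * deriv f x₀) /
      ((y - x₀ : ℝ) : ℂ) ^ 2)).re ≤ 0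
    rw [← mul_div_assoc, ← Complex.ofReal_pow, Complex.div_ofReal_re]
    refine div_nonpos_of_nonpos_of_nonneg ?_ (sq_nonneg _)
    rw [mul_sub, mul_sub, mul_left_comm, Complex.sub_re, Complex.sub_re,
      Complex.re_ofReal_mul, hd, mul_zero, sub_zero, sub_nonpos]
    exact re_conj_mul_le_of_norm_le (hmax y)
  · rw [integral_undef hint, mul_zero, Complex.zero_re]
end

section
/- Let ν be a finite positive Borel measure on ℝ and let f : ℝ → ℂ be differentiable with bounded derivative f' satisfying ∫_ℝ |f'(x)| dx < ∞. Then for every a > 0: ∫_ℝ ∫_ℝ |(f(x) − f(y))/(x−y)|² dν(y) dx ≤ 2·ν(ℝ)·( a·(sup_u |f'(u)|)² + (1/a)·(∫_ℝ |f'(u)| du)² ). In particular the carré du champ D(f,f)(x) = ∫_ℝ |(f(x) − f(y))/(x−y)|² dν(y) is integrable with respect to Lebesgue measure. -/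
open MeasureTheory

theorem lintegral_Ioi_ofReal_inv_sq {a : ℝ} (ha : 0 < a) :
    ∫⁻ t in Set.Ioi a, ENNReal.ofReal ((t ^ 2)⁻¹) = ENNReal.ofReal a⁻¹ := by
  have hrpow : Set.EqOn (fun t : ℝ => t ^ (-2 : ℝ)) (fun t => (t ^ 2)⁻¹) (Set.Ioi a) := by
    intro t ht
    have ht : 0 < t := ha.trans ht
    simp [Real.rpow_neg ht.le]
  have hint : IntegrableOn (fun t : ℝ => (t ^ 2)⁻¹) (Set.Ioi a) :=
    (integrableOn_Ioi_rpow_of_lt (by norm_num) ha).congr_fun hrpow measurableSet_Ioi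
  rw [← ofReal_integral_eq_lintegral_ofReal hint (.of_forall fun t => by positivity),
    ← setIntegral_congr_fun measurableSet_Ioi hrpow, integral_Ioi_rpow_of_lt (by norm_num) ha]
  norm_num [Real.rpow_neg_one]

theorem lintegral_Iio_neg_ofReal_inv_sq {a : ℝ} (ha : 0 < a) :
    ∫⁻ t in Set.Iio (-a), ENNReal.ofReal ((t ^ 2)⁻¹) = ENNReal.ofReal a⁻¹ := by
  rw [← lintegral_Ioi_ofReal_inv_sq ha, ← (Measure.measurePreserving_neg
    (volume : Measure ℝ)).setLIntegral_comp_preimage_emb (MeasurableEquiv.neg ℝ).measurableEmbedding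
    _ (Set.Iio (-a))]
  simp

theorem norm_sub_le_integral_norm_deriv {f : ℝ → ℂ} (hf : Differentiable ℝ f)
    (hint : Integrable (deriv f)) (x y : ℝ) : ‖f x - f y‖ ≤ ∫ u, ‖deriv f u‖ := by
  rw [← intervalIntegral.integral_eq_sub_of_hasDerivAt (fun u _ => (hf u).hasDerivAt)
    hint.intervalIntegrable]
  exact intervalIntegral.norm_integral_le_integral_norm_uIoc.trans
    (setIntegral_le_integral hint.norm (.of_forall fun u => norm_nonneg _))

/-- The squared difference quotient of a function which is `M`-Lipschitz and of oscillation at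
most `L` has integral at most `2 (a M² + L² / a)`. -/
theorem lintegral_nnnorm_sub_div_sq_le {f : ℝ → ℂ} {M L a : ℝ} (ha : 0 < a) (hM : 0 ≤ M)
    (hfM : ∀ x y, ‖f x - f y‖ ≤ M * |x - y|) (hfL : ∀ x y, ‖f x - f y‖ ≤ L) (y : ℝ) :
    ∫⁻ x, (‖(f x - f y) / ((x - y : ℝ) : ℂ)‖₊ : ENNReal) ^ 2
      ≤ ENNReal.ofReal (2 * (a * M ^ 2 + (1 / a) * L ^ 2)) := by
  let q : ℝ → ENNReal := fun t => ENNReal.ofReal (L ^ 2) * ENNReal.ofReal ((t ^ 2)⁻¹)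
  let g : ℝ → ENNReal := fun t => (Set.Icc (-a) a).indicator (fun _ => ENNReal.ofReal (M ^ 2)) t +
    ((Set.Ioi a).indicator q t + (Set.Iio (-a)).indicator q t)
  have hq : Measurable q := by fun_prop
  have hfg : ∀ x, (‖(f x - f y) / ((x - y : ℝ) : ℂ)‖₊ : ENNReal) ^ 2 ≤ g (x - y) := by
    intro x
    have hval : (‖(f x - f y) / ((x - y : ℝ) : ℂ)‖₊ : ENNReal) ^ 2
        = ENNReal.ofReal ((‖f x - f y‖ / |x - y|) ^ 2) := by
      rw [← enorm_eq_nnnorm, ← ofReal_norm, ← ENNReal.ofReal_pow (norm_nonneg _),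
        norm_div, Complex.norm_real, Real.norm_eq_abs]
    have hfar : (‖(f x - f y) / ((x - y : ℝ) : ℂ)‖₊ : ENNReal) ^ 2 ≤ q (x - y) := by
      simp only [q]
      rw [hval, ← ENNReal.ofReal_mul (by positivity), div_pow, sq_abs, ← div_eq_mul_inv]
      gcongr
      exact hfL x y
    by_cases hmem : x - y ∈ Set.Icc (-a) a
    · refine le_trans ?_ le_self_add
      rw [Set.indicator_of_mem hmem, hval]
      gcongr
      exact div_le_of_le_mul₀ (abs_nonneg _) hM (hfM x y)
    · refine le_trans ?_ le_add_self
      rw [Set.mem_Icc, not_and_or, not_le, not_le] at hmem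
      rcases hmem with h | h
      · exact le_add_left (hfar.trans_eq (Set.indicator_of_mem (Set.mem_Iio.2 h) q).symm)
      · exact le_add_right (hfar.trans_eq (Set.indicator_of_mem (Set.mem_Ioi.2 h) q).symm)
  calc ∫⁻ x, (‖(f x - f y) / ((x - y : ℝ) : ℂ)‖₊ : ENNReal) ^ 2
      ≤ ∫⁻ x, g (x - y) := lintegral_mono hfg
    _ = ∫⁻ t, g t := lintegral_sub_right_eq_self g y
    _ = ENNReal.ofReal (M ^ 2) * ENNReal.ofReal (a - -a) +
        (ENNReal.ofReal (L ^ 2) * ENNReal.ofReal a⁻¹ +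
          ENNReal.ofReal (L ^ 2) * ENNReal.ofReal a⁻¹) := by
      rw [lintegral_add_left (measurable_const.indicator measurableSet_Icc),
        lintegral_add_left (hq.indicator measurableSet_Ioi),
        lintegral_indicator_const measurableSet_Icc, Real.volume_Icc,
        lintegral_indicator measurableSet_Ioi, lintegral_indicator measurableSet_Iio,
        lintegral_const_mul _ (by fun_prop), lintegral_const_mul _ (by fun_prop),
        lintegral_Ioi_ofReal_inv_sq ha, lintegral_Iio_neg_ofReal_inv_sq ha]
    _ = ENNReal.ofReal (2 * (a * M ^ 2 + (1 / a) * L ^ 2)) := by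
      rw [← ENNReal.ofReal_mul (by positivity), ← ENNReal.ofReal_mul (by positivity),
        ← ENNReal.ofReal_add (by positivity) (by positivity),
        ← ENNReal.ofReal_add (mul_nonneg (by positivity) (by linarith)) (by positivity)]
      congr 1
      ring

/-- Integrability estimate for the carré du champ: for a finite measure `ν` and a
differentiable `f` with bounded, Lebesgue-integrable derivative, for every `a > 0`,
`∫∫ |(f(x)-f(y))/(x-y)|² dν(y) dx ≤ 2 ν(ℝ) ( a (sup|f'|)² + (1/a) (∫|f'|)² )`. -/
theorem stmt_18 (ν : Measure ℝ) [IsFiniteMeasure ν] (f : ℝ → ℂ)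
    (hf : Differentiable ℝ f)
    (hbdd : BddAbove (Set.range fun u => ‖deriv f u‖))
    (hint : Integrable (deriv f) volume)
    (a : ℝ) (ha : 0 < a) :
    ∫⁻ x, ∫⁻ y, (‖(f x - f y) / ((x - y : ℝ) : ℂ)‖₊ : ENNReal) ^ 2 ∂ν
      ≤ ENNReal.ofReal (2 * (ν Set.univ).toReal *
          (a * (⨆ u, ‖deriv f u‖) ^ 2 + (1 / a) * (∫ u, ‖deriv f u‖) ^ 2)) := by
  have hlip (x y : ℝ) : ‖f x - f y‖ ≤ (⨆ u, ‖deriv f u‖) * |x - y| :=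
    convex_univ.norm_image_sub_le_of_norm_deriv_le (fun u _ => hf u) (fun u _ => le_ciSup hbdd u)
      (Set.mem_univ y) (Set.mem_univ x)
  have hmeas : Measurable f := hf.continuous.measurable
  rw [lintegral_lintegral_swap (by unfold Function.uncurry; fun_prop)]
  refine (lintegral_mono fun y => lintegral_nnnorm_sub_div_sq_le ha
    (Real.iSup_nonneg fun u => norm_nonneg _) hlip
    (norm_sub_le_integral_norm_deriv hf hint) y).trans_eq ?_
  rw [lintegral_const, ← ENNReal.ofReal_toReal (measure_ne_top ν Set.univ),
    ← ENNReal.ofReal_mul (by positivity), ENNReal.ofReal_toReal (measure_ne_top ν Set.univ)]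
  congr 1
  ring
end

section
/- Let ν be a positive Borel measure on ℝ with finite moments of all orders, m_k = ∫_ℝ x^k dν(x). Define, on the space of complex polynomials, the operator L_{δ₀} by L_{δ₀} f = q, where q is the unique polynomial with f(x) = f(0) + x·q(x), and define L_ν f(x) = ∫_ℝ (f(x) − f(y))/(x−y) dν(y) (the integrand is a polynomial in y, so the integral converges). Then for every polynomial f of degree n and every x ∈ ℝ: L_ν f(x) = Σ_{k=0}^{n−1} m_k · (L_{δ₀}^{k+1} f)(x), where L_{δ₀}^{k+1} denotes the (k+1)-fold composition of L_{δ₀}. In particular, L_ν f = M_ν(L_{δ₀}) L_{δ₀} f where M_ν(z) = Σ_k m_k z^k is the moment generating function of ν, interpreted as a (finite) operator sum on polynomials. -/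
open MeasureTheory Polynomial

/-- The divided difference `(f(x) - f(y))/(x - y)` of a polynomial, extended to the
diagonal (where it equals the derivative, since it is a polynomial in `y`). -/
noncomputable def polyDiffQuot (f : Polynomial ℂ) (x y : ℝ) : ℂ :=
  if y = x then (Polynomial.derivative f).eval (x : ℂ)
  else (f.eval (x : ℂ) - f.eval (y : ℂ)) / ((x : ℂ) - (y : ℂ))

theorem sub_mul_sum_divX_iterate {R : Type*} [CommRing R] (a b : R) (N : ℕ) (f : R[X])
    (hf : f.natDegree ≤ N) :
    (a - b) * ∑ k ∈ Finset.range N, b ^ k * (divX^[k + 1] f).eval a = f.eval a - f.eval b := by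
  induction N generalizing f with
  | zero =>
    rw [eq_C_of_natDegree_le_zero hf]
    simp
  | succ N ih =>
    have hg := ih f.divX (by rw [natDegree_divX_eq_natDegree_tsub_one]; omega)
    have hsum : ∑ k ∈ Finset.range N, b ^ (k + 1) * (divX^[k + 1 + 1] f).eval a
        = b * ∑ k ∈ Finset.range N, b ^ k * (divX^[k + 1] f.divX).eval a := by
      rw [Finset.mul_sum]
      refine Finset.sum_congr rfl fun k _ => ?_
      rw [Function.iterate_succ_apply, pow_succ']
      ring
    have heval (t : R) : f.eval t = f.divX.eval t * t + f.coeff 0 := by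
      conv_lhs => rw [← divX_mul_X_add f]
      simp
    rw [Finset.sum_range_succ', hsum, heval a, heval b]
    simp only [zero_add, Function.iterate_one, pow_zero, one_mul]
    linear_combination b * hg

theorem sum_pow_mul_divX_iterate_eq_derivative {R : Type*} [CommRing R] (a : R) (N : ℕ)
    (f : R[X]) (hf : f.natDegree ≤ N) :
    ∑ k ∈ Finset.range N, a ^ k * (divX^[k + 1] f).eval a = (derivative f).eval a := by
  induction N generalizing f with
  | zero =>
    rw [eq_C_of_natDegree_le_zero hf]
    simp
  | succ N ih =>
    have hg := ih f.divX (by rw [natDegree_divX_eq_natDegree_tsub_one]; omega)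
    have hsum : ∑ k ∈ Finset.range N, a ^ (k + 1) * (divX^[k + 1 + 1] f).eval a
        = a * ∑ k ∈ Finset.range N, a ^ k * (divX^[k + 1] f.divX).eval a := by
      rw [Finset.mul_sum]
      refine Finset.sum_congr rfl fun k _ => ?_
      rw [Function.iterate_succ_apply, pow_succ']
      ring
    have hder : (derivative f).eval a = (derivative f.divX).eval a * a + f.divX.eval a := by
      conv_lhs => rw [← divX_mul_X_add f]
      simp
    rw [Finset.sum_range_succ', hsum, hder, hg]
    simp only [zero_add, Function.iterate_one, pow_zero, one_mul]
    ring

theorem polyDiffQuot_eq_sum (f : ℂ[X]) (x y : ℝ) :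
    polyDiffQuot f x y
      = ∑ k ∈ Finset.range f.natDegree, (y : ℂ) ^ k * (divX^[k + 1] f).eval (x : ℂ) := by
  unfold polyDiffQuot
  split_ifs with h
  · rw [h, sum_pow_mul_divX_iterate_eq_derivative _ _ f le_rfl]
  · have hne : (x : ℂ) - y ≠ 0 := sub_ne_zero.2 fun hxy => h (Complex.ofReal_injective hxy).symm
    rw [div_eq_iff hne, mul_comm, sub_mul_sum_divX_iterate _ _ _ f le_rfl]

/-- Pseudo-differential interpretation of `L_ν` on polynomials: with
`L_{δ₀} f = divX f` (the polynomial `q` with `f(x) = f(0) + x q(x)`) and moments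
`m_k = ∫ y^k dν(y)`, for any polynomial `f` of degree `n`,
`L_ν f(x) = ∑_{k=0}^{n-1} m_k (L_{δ₀}^{k+1} f)(x)`. -/
theorem stmt_19 (ν : Measure ℝ)
    (hmom : ∀ k : ℕ, Integrable (fun y => y ^ k) ν)
    (f : Polynomial ℂ) (x : ℝ) :
    ∫ y, polyDiffQuot f x y ∂ν
      = ∑ k ∈ Finset.range f.natDegree,
          ((∫ y, y ^ k ∂ν : ℝ) : ℂ) * (Polynomial.divX^[k + 1] f).eval (x : ℂ) := by
  have hpow (k : ℕ) : Integrable (fun y : ℝ => (y : ℂ) ^ k) ν := by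
    simpa using (hmom k).ofReal (𝕜 := ℂ)
  simp_rw [polyDiffQuot_eq_sum]
  rw [integral_finsetSum _ fun k _ => (hpow k).mul_const _]
  refine Finset.sum_congr rfl fun k _ => ?_
  rw [integral_mul_const, ← integral_complex_ofReal]
  simp
end
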